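/- arXiv:2308.08907 — 8 statements merged into one kernel-verified Lean document; each statement's English description precedes it below -/
import Mathlib

section
/- Let p be a prime and let q_1 < q_2 < q_3 be primes such that q_1 q_2 q_3 is coprime to p(p−1). Define the binary form g_2(x_1,x_2) = x_1^{q_1 q_2} · ∏_{i=1}^{q_1} (x_1 + p^i x_2)^{q_1 q_3} · (x_1 + p^{q_1+1} x_2)^{q_2 q_3} · ∏_{i=1}^{q_3−1} (p^i x_1 + x_2)^{q_1 q_2} · ∏_{i=q_3}^{q_3+q_2−q_1−1} (p^i x_1 + x_2)^{q_1 q_3} · ∏_{i=q_3+q_2−q_1}^{q_3+q_2−2} (p^i x_1 + x_2)^{q_2 q_3} ∈ ℤ[x_1,x_2]. Then for every prime q > p^{q_1+q_2+q_3−1}, R(g_2) is NOT dense in ℚ_q. -/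
open MvPolynomial

/-- The ratio set of an integral form, viewed in `ℚ_[p]`. -/
def ratioSet (p : ℕ) [Fact p.Prime] {n : ℕ} (F : MvPolynomial (Fin n) ℤ) : Set ℚ_[p] :=
  { t | ∃ x y : Fin n → ℤ, MvPolynomial.eval y F ≠ 0 ∧
      t = (MvPolynomial.eval x F : ℚ_[p]) / (MvPolynomial.eval y F : ℚ_[p]) }

/-- The value at `(x, y)` of the product of the linear forms `X + p ^ i Y` with `i ∈ s` and
`p ^ i X + Y` with `i ∈ t`. -/
def linProd (p : ℕ) (s t : Finset ℕ) (x y : ℤ) : ℤ :=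
  (∏ i ∈ s, (x + (p : ℤ) ^ i * y)) * ∏ i ∈ t, ((p : ℤ) ^ i * x + y)

lemma linProd_mul_left (p : ℕ) (s t : Finset ℕ) (d x y : ℤ) :
    linProd p s t (d * x) (d * y) = d ^ (s.card + t.card) * linProd p s t x y := by
  have hs : ∀ i : ℕ, d * x + (p : ℤ) ^ i * (d * y) = d * (x + (p : ℤ) ^ i * y) := fun i ↦ by ring
  have ht : ∀ i : ℕ, (p : ℤ) ^ i * (d * x) + d * y = d * ((p : ℤ) ^ i * x + y) := fun i ↦ by ring
  simp only [linProd, hs, ht, Finset.prod_mul_distrib, Finset.prod_const, pow_add]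
  ring

section Residue

variable {p q : ℕ} [Fact q.Prime]

lemma exists_zpow_of_dvd_linProd (hp : (p : ZMod q) ≠ 0) {s t : Finset ℕ} {x y : ℤ}
    (h : (q : ℤ) ∣ linProd p s t x y) :
    ∃ k : ℤ, ((∃ i ∈ s, k = i) ∨ ∃ i ∈ t, k = -i) ∧
      (x : ZMod q) = -((p : ZMod q) ^ k * (y : ZMod q)) := by
  have hq : Prime (q : ℤ) := Nat.prime_iff_prime_int.mp Fact.out
  rcases hq.dvd_or_dvd h with h | h
  · obtain ⟨i, hi, h⟩ := (hq.dvd_finsetProd_iff _).mp h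
    refine ⟨i, .inl ⟨i, hi, rfl⟩, ?_⟩
    rw [← ZMod.intCast_zmod_eq_zero_iff_dvd] at h
    push_cast at h
    rw [zpow_natCast]
    exact eq_neg_of_add_eq_zero_left h
  · obtain ⟨i, hi, h⟩ := (hq.dvd_finsetProd_iff _).mp h
    refine ⟨-i, .inr ⟨i, hi, rfl⟩, ?_⟩
    rw [← ZMod.intCast_zmod_eq_zero_iff_dvd] at h
    push_cast at h
    rw [zpow_neg, zpow_natCast, eq_neg_of_add_eq_zero_right h, mul_neg, neg_neg,
      inv_mul_cancel_left₀ (pow_ne_zero i hp)]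

lemma eq_of_zpow_eq_zpow (hp1 : 1 < p) {N : ℕ} (hN : p ^ N < q) {k l : ℤ} (hkl : |k - l| ≤ N)
    (h : (p : ZMod q) ^ k = (p : ZMod q) ^ l) : k = l := by
  wlog hle : l ≤ k generalizing k l
  · exact (this (by rwa [abs_sub_comm]) h.symm (by omega)).symm
  obtain ⟨n, hn⟩ := Int.eq_ofNat_of_zero_le (sub_nonneg.mpr hle)
  have hnN : n ≤ N := by
    rw [hn] at hkl
    simpa using hkl
  have hlt : p ^ n < q := (Nat.pow_le_pow_right hp1.le hnN).trans_lt hN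
  by_cases hn0 : n = 0
  · omega
  have hpq : p < q := (Nat.le_self_pow hn0 p).trans_lt hlt
  have hp0 : (p : ZMod q) ≠ 0 := by
    rw [Ne, ZMod.natCast_eq_zero_iff]
    exact Nat.not_dvd_of_pos_of_lt (by omega) hpq
  have h1 : (p : ZMod q) ^ n = 1 := by
    rw [← zpow_natCast, show (n : ℤ) = k - l from hn.symm, zpow_sub₀ hp0, h,
      div_self (zpow_ne_zero l hp0)]
  have h2 : ((p ^ n : ℕ) : ZMod q) = ((1 : ℕ) : ZMod q) := by simpa using h1
  rw [ZMod.natCast_eq_natCast_iff', Nat.mod_eq_of_lt hlt, Nat.mod_eq_of_lt (by omega)] at h2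
  exact absurd h2 (Nat.one_lt_pow hn0 hp1).ne'

lemma not_dvd_linProd_of_dvd_linProd (hp1 : 1 < p) (hp : (p : ZMod q) ≠ 0) {N : ℕ}
    (hN : p ^ N < q) {x y : ℤ} (hxy : (x : ZMod q) ≠ 0 ∨ (y : ZMod q) ≠ 0) {s t s' t' : Finset ℕ}
    (hss : Disjoint s s') (htt : Disjoint t t') (h0 : 0 ∉ t) (h0' : 0 ∉ t')
    (hs : ∀ i ∈ s, ∀ j ∈ t', i + j ≤ N) (hs' : ∀ i ∈ s', ∀ j ∈ t, i + j ≤ N)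
    (hsN : ∀ i ∈ s ∪ s' ∪ t ∪ t', i ≤ N)
    (h : (q : ℤ) ∣ linProd p s t x y) : ¬ (q : ℤ) ∣ linProd p s' t' x y := by
  intro h'
  obtain ⟨k, hk, hxk⟩ := exists_zpow_of_dvd_linProd hp h
  obtain ⟨l, hl, hxl⟩ := exists_zpow_of_dvd_linProd hp h'
  have hy : (y : ZMod q) ≠ 0 := by
    rintro hy
    simp_all
  have hkl : (p : ZMod q) ^ k = (p : ZMod q) ^ l :=
    mul_right_cancel₀ hy (neg_injective (hxk.symm.trans hxl))
  have hle : |k - l| ≤ N := by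
    rw [abs_le]
    rcases hk with ⟨i, hi, rfl⟩ | ⟨i, hi, rfl⟩ <;> rcases hl with ⟨j, hj, rfl⟩ | ⟨j, hj, rfl⟩
    · have := hsN i (by simp [hi]); have := hsN j (by simp [hj]); omega
    · have := hs i hi j hj; omega
    · have := hs' j hj i hi; omega
    · have := hsN i (by simp [hi]); have := hsN j (by simp [hj]); omega
  have hkl' := eq_of_zpow_eq_zpow hp1 hN hle hkl
  rcases hk with ⟨i, hi, rfl⟩ | ⟨i, hi, rfl⟩ <;> rcases hl with ⟨j, hj, rfl⟩ | ⟨j, hj, rfl⟩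
  · exact Finset.disjoint_left.mp hss hi (by rwa [Nat.cast_inj.mp hkl'])
  · exact h0' (by rwa [show j = 0 by omega] at hj)
  · exact h0 (by rwa [show i = 0 by omega] at hi)
  · exact Finset.disjoint_left.mp htt hi (by rwa [show i = j by omega])

lemma not_dvd_linProd_of_dvd (hp : (p : ZMod q) ≠ 0) {x y : ℤ}
    (hxy : (x : ZMod q) ≠ 0 ∨ (y : ZMod q) ≠ 0) {s t : Finset ℕ}
    (h : (q : ℤ) ∣ x) : ¬ (q : ℤ) ∣ linProd p s t x y := by
  intro h'
  obtain ⟨k, -, hxk⟩ := exists_zpow_of_dvd_linProd hp h'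
  rw [← ZMod.intCast_zmod_eq_zero_iff_dvd] at h
  have hpk := zpow_ne_zero k hp
  simp_all

end Residue

lemma padicValInt.pow {q : ℕ} [Fact q.Prime] (z : ℤ) (n : ℕ) :
    padicValInt q (z ^ n) = n * padicValInt q z := by
  rw [padicValInt, Int.natAbs_pow, padicValNat.pow, padicValInt]

/-- A product of three forms of degrees `c, b, a`, raised to the powers `ab, ac, bc`, at most one of
which is divisible by `q` at a primitive vector, has `q`-adic valuation divisible by one of the
exponents. -/
lemma dvd_padicValInt_mul_pow {q a b c : ℕ} [Fact q.Prime] {d A B D : ℤ}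
    (h : (d ^ c * A) ^ (a * b) * (d ^ b * B) ^ (a * c) * (d ^ a * D) ^ (b * c) ≠ 0)
    (ha : a ≠ 0) (hb : b ≠ 0) (hc : c ≠ 0)
    (hAB : (q : ℤ) ∣ A → ¬ (q : ℤ) ∣ B) (hAD : (q : ℤ) ∣ A → ¬ (q : ℤ) ∣ D)
    (hBD : (q : ℤ) ∣ B → ¬ (q : ℤ) ∣ D) :
    ∃ e, (e = a * b ∨ e = a * c ∨ e = b * c) ∧ e ∣ padicValInt q
      ((d ^ c * A) ^ (a * b) * (d ^ b * B) ^ (a * c) * (d ^ a * D) ^ (b * c)) := by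
  obtain ⟨⟨⟨hd, hA⟩, hB⟩, hD⟩ : ((d ≠ 0 ∧ A ≠ 0) ∧ B ≠ 0) ∧ D ≠ 0 := by
    refine ⟨⟨⟨?_, ?_⟩, ?_⟩, ?_⟩ <;> rintro rfl <;> simp [ha, hb, hc] at h
  have hval : padicValInt q
      ((d ^ c * A) ^ (a * b) * (d ^ b * B) ^ (a * c) * (d ^ a * D) ^ (b * c)) =
      3 * (a * b * c) * padicValInt q d + a * b * padicValInt q A + a * c * padicValInt q B +
        b * c * padicValInt q D := by
    rw [padicValInt.mul (by positivity) (by positivity),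
      padicValInt.mul (by positivity) (by positivity)]
    simp only [padicValInt.pow]
    rw [padicValInt.mul (by positivity) hA, padicValInt.mul (by positivity) hB,
      padicValInt.mul (by positivity) hD]
    simp only [padicValInt.pow]
    ring
  rw [hval]
  by_cases hqA : (q : ℤ) ∣ A
  · rw [padicValInt.eq_zero_of_not_dvd (hAB hqA), padicValInt.eq_zero_of_not_dvd (hAD hqA)]
    exact ⟨_, .inl rfl, ⟨3 * c * padicValInt q d + padicValInt q A, by ring⟩⟩
  rw [padicValInt.eq_zero_of_not_dvd hqA]
  by_cases hqB : (q : ℤ) ∣ B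
  · rw [padicValInt.eq_zero_of_not_dvd (hBD hqB)]
    exact ⟨_, .inr (.inl rfl), ⟨3 * b * padicValInt q d + padicValInt q B, by ring⟩⟩
  rw [padicValInt.eq_zero_of_not_dvd hqB]
  exact ⟨_, .inr (.inr rfl), ⟨3 * a * padicValInt q d + padicValInt q D, by ring⟩⟩

/-- If no two nonzero values of `F` have `q`-adic valuations differing by one, then the ratio set
of `F` is not dense, as it misses a neighbourhood of `q`. -/
lemma not_dense_ratioSet {q : ℕ} [Fact q.Prime] {n : ℕ} {F : MvPolynomial (Fin n) ℤ}
    (h : ∀ x y : Fin n → ℤ, eval x F ≠ 0 → eval y F ≠ 0 →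
      padicValInt q (eval x F) ≠ padicValInt q (eval y F) + 1) :
    ¬ Dense (ratioSet q F) := by
  intro hd
  have hq0 : (q : ℚ_[q]) ≠ 0 := by exact_mod_cast (Fact.out : q.Prime).ne_zero
  obtain ⟨_, ⟨x, y, hy, rfl⟩, hdist⟩ := hd.exists_dist_lt (q : ℚ_[q]) (norm_pos_iff.mpr hq0)
  have hnorm := Padic.norm_eq_of_norm_sub_lt_left (dist_eq_norm (q : ℚ_[q]) _ ▸ hdist)
  have hy' : (eval y F : ℚ_[q]) ≠ 0 := by exact_mod_cast hy
  have hx : eval x F ≠ 0 := by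
    intro hx
    rw [hx, Int.cast_zero, zero_div, norm_zero, norm_eq_zero] at hnorm
    exact hq0 hnorm
  have hx' : (eval x F : ℚ_[q]) ≠ 0 := by exact_mod_cast hx
  rw [norm_div, eq_div_iff (norm_ne_zero_iff.mpr hy'), ← norm_mul,
    Padic.norm_eq_zpow_neg_valuation (mul_ne_zero hq0 hy'),
    Padic.norm_eq_zpow_neg_valuation hx', Padic.valuation_mul hq0 hy', Padic.valuation_p,
    Padic.valuation_intCast, Padic.valuation_intCast] at hnorm
  have hq1 : (1 : ℝ) < q := by exact_mod_cast (Fact.out : q.Prime).one_lt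
  have := zpow_right_injective₀ (by linarith) hq1.ne' hnorm
  exact h x y hx hy (by omega)

/-- Let `p` be a prime and `q₁ < q₂ < q₃` primes with `q₁q₂q₃` coprime to `p(p-1)`. For the
binary form `g₂` of the paper and every prime `q > p^{q₁+q₂+q₃-1}`, `R(g₂)` is not dense
in `ℚ_q`. -/
theorem stmt8 (p q1 q2 q3 : ℕ) [Fact p.Prime]
    (h1 : q1.Prime) (h2 : q2.Prime) (h3 : q3.Prime)
    (h12 : q1 < q2) (h23 : q2 < q3)
    (hcop : Nat.Coprime (q1 * q2 * q3) (p * (p - 1)))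
    (g2 : MvPolynomial (Fin 2) ℤ)
    (hg2 : g2 = X 0 ^ (q1 * q2) *
      (∏ i ∈ Finset.Icc 1 q1, (X 0 + C ((p : ℤ) ^ i) * X 1) ^ (q1 * q3)) *
      (X 0 + C ((p : ℤ) ^ (q1 + 1)) * X 1) ^ (q2 * q3) *
      (∏ i ∈ Finset.Icc 1 (q3 - 1), (C ((p : ℤ) ^ i) * X 0 + X 1) ^ (q1 * q2)) *
      (∏ i ∈ Finset.Icc q3 (q3 + q2 - q1 - 1), (C ((p : ℤ) ^ i) * X 0 + X 1) ^ (q1 * q3)) *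
      (∏ i ∈ Finset.Icc (q3 + q2 - q1) (q3 + q2 - 2), (C ((p : ℤ) ^ i) * X 0 + X 1) ^ (q2 * q3))) :
    ∀ q : ℕ, ∀ _ : Fact q.Prime, p ^ (q1 + q2 + q3 - 1) < q → ¬ Dense (ratioSet q g2) := by
  intro q hq hlt
  have hp1 : 1 < p := (Fact.out : p.Prime).one_lt
  have h1' := h1.two_le
  have hp : (p : ZMod q) ≠ 0 := by
    rw [Ne, ZMod.natCast_eq_zero_iff]
    exact Nat.not_dvd_of_pos_of_lt (by omega)
      ((Nat.le_self_pow (by omega) p).trans_lt hlt)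
  have heval : ∀ x : Fin 2 → ℤ, eval x g2 =
      (x 0 * linProd p ∅ (Finset.Icc 1 (q3 - 1)) (x 0) (x 1)) ^ (q1 * q2) *
      linProd p (Finset.Icc 1 q1) (Finset.Icc q3 (q3 + q2 - q1 - 1)) (x 0) (x 1) ^ (q1 * q3) *
      linProd p {q1 + 1} (Finset.Icc (q3 + q2 - q1) (q3 + q2 - 2)) (x 0) (x 1) ^ (q2 * q3) := by
    intro x
    simp only [hg2, linProd, map_mul, map_prod, map_pow, map_add, eval_X, eval_C, mul_pow,
      Finset.prod_pow, Finset.prod_empty, Finset.prod_singleton, one_pow]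
    ring
  have key : ∀ x : Fin 2 → ℤ, eval x g2 ≠ 0 →
      ∃ e, (e = q1 * q2 ∨ e = q1 * q3 ∨ e = q2 * q3) ∧ e ∣ padicValInt q (eval x g2) := by
    intro x hx
    have hgcd : 0 < (x 0).gcd (x 1) := by
      rw [Int.gcd_pos_iff]
      by_contra! h0
      simp [heval, linProd, h0, h1.ne_zero, h2.ne_zero] at hx
    obtain ⟨u, v, huv, hu, hv⟩ := Int.exists_gcd_one hgcd
    set d : ℤ := ((x 0).gcd (x 1) : ℤ)
    have huv' : (u : ZMod q) ≠ 0 ∨ (v : ZMod q) ≠ 0 := by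
      by_contra! h0
      rw [ZMod.intCast_zmod_eq_zero_iff_dvd, ZMod.intCast_zmod_eq_zero_iff_dvd] at h0
      have := Int.dvd_coe_gcd h0.1 h0.2
      rw [huv] at this
      exact hq.out.one_lt.ne' (by simpa using Int.eq_one_of_dvd_one (by positivity) this)
    have hform : eval x g2 =
        (d ^ q3 * (u * linProd p ∅ (Finset.Icc 1 (q3 - 1)) u v)) ^ (q1 * q2) *
        (d ^ q2 * linProd p (Finset.Icc 1 q1) (Finset.Icc q3 (q3 + q2 - q1 - 1)) u v) ^ (q1 * q3) *
        (d ^ q1 * linProd p {q1 + 1} (Finset.Icc (q3 + q2 - q1) (q3 + q2 - 2)) u v) ^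
          (q2 * q3) := by
      rw [heval, hu, hv, mul_comm u, mul_comm v, linProd_mul_left, linProd_mul_left,
        linProd_mul_left]
      simp only [Nat.card_Icc, Finset.card_empty, Finset.card_singleton]
      rw [show q1 + 1 - 1 + (q3 + q2 - q1 - 1 + 1 - q3) = q2 by omega,
        show 1 + (q3 + q2 - 2 + 1 - (q3 + q2 - q1)) = q1 by omega,
        show 0 + (q3 - 1 + 1 - 1) = q3 - 1 by omega,
        show d * u * (d ^ (q3 - 1) * linProd p ∅ (Finset.Icc 1 (q3 - 1)) u v) =
          d ^ (q3 - 1 + 1) * (u * linProd p ∅ (Finset.Icc 1 (q3 - 1)) u v) by ring,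
        show q3 - 1 + 1 = q3 by omega]
    have hpr : Prime (q : ℤ) := Nat.prime_iff_prime_int.mp Fact.out
    rw [hform] at hx ⊢
    refine dvd_padicValInt_mul_pow hx h1.ne_zero h2.ne_zero h3.ne_zero (fun h ↦ ?_) (fun h ↦ ?_) ?_
    · rcases hpr.dvd_or_dvd h with h | h
      · exact not_dvd_linProd_of_dvd hp huv' h
      · refine not_dvd_linProd_of_dvd_linProd hp1 hp hlt huv' ?_ ?_ ?_ ?_ ?_ ?_ ?_ h <;>
          simp only [Finset.disjoint_left, Finset.mem_union, Finset.mem_Icc, Finset.notMem_empty,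
            false_or, false_imp_iff, implies_true] <;> intros <;> omega
    · rcases hpr.dvd_or_dvd h with h | h
      · exact not_dvd_linProd_of_dvd hp huv' h
      · refine not_dvd_linProd_of_dvd_linProd hp1 hp hlt huv' ?_ ?_ ?_ ?_ ?_ ?_ ?_ h <;>
          simp only [Finset.disjoint_left, Finset.mem_union, Finset.mem_Icc, Finset.notMem_empty,
            Finset.mem_singleton, false_or, false_imp_iff, implies_true] <;> intros <;> omega
    · refine not_dvd_linProd_of_dvd_linProd hp1 hp hlt huv' ?_ ?_ ?_ ?_ ?_ ?_ ?_ <;>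
        simp only [Finset.disjoint_left, Finset.mem_union, Finset.mem_Icc, Finset.mem_singleton] <;>
        intros <;> omega
  refine not_dense_ratioSet fun x y hx hy hxy ↦ ?_
  obtain ⟨e, he, hex⟩ := key x hx
  obtain ⟨f, hf, hfy⟩ := key y hy
  obtain ⟨r, hr, hre, hrf⟩ : ∃ r : ℕ, r.Prime ∧ r ∣ e ∧ r ∣ f := by
    rcases he with rfl | rfl | rfl <;> rcases hf with rfl | rfl | rfl <;>
    first
      | exact ⟨q1, h1, by simp, by simp⟩
      | exact ⟨q2, h2, by simp, by simp⟩
      | exact ⟨q3, h3, by simp, by simp⟩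
  have hr1 : r ∣ 1 := (Nat.dvd_add_right (hrf.trans hfy)).mp (hxy ▸ hre.trans hex)
  exact hr.one_lt.ne' (Nat.dvd_one.mp hr1)
end

section
/- Let p be a prime and let q_1 < q_2 < q_3 be primes such that q_1 q_2 q_3 is coprime to p(p−1). Let g_2(x_1,x_2) = x_1^{q_1 q_2} · ∏_{i=1}^{q_1} (x_1 + p^i x_2)^{q_1 q_3} · (x_1 + p^{q_1+1} x_2)^{q_2 q_3} · ∏_{i=1}^{q_3−1} (p^i x_1 + x_2)^{q_1 q_2} · ∏_{i=q_3}^{q_3+q_2−q_1−1} (p^i x_1 + x_2)^{q_1 q_3} · ∏_{i=q_3+q_2−q_1}^{q_3+q_2−2} (p^i x_1 + x_2)^{q_2 q_3}, and for an integer n > 2 define g_n(x_1,…,x_n) = g_2(x_1,x_2) · (x_3 ⋯ x_n)^{q_1 q_2 q_3} ∈ ℤ[x_1,…,x_n]. Then R(g_n) is dense in ℚ_p, and for every prime q > p^{q_1+q_2+q_3−1}, R(g_n) is NOT dense in ℚ_q. -/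
open MvPolynomial

theorem Padic.exists_pow_eq_of_valuation {p : ℕ} [hp : Fact p.Prime] {N : ℕ}
    (hN : N.Coprime (p * (p - 1))) {u : ℚ_[p]} (hu : u ≠ 0) {s : ℤ}
    (hs : u.valuation = N * s) : ∃ r : ℚ_[p], r ^ N = u := by
  have hpp := hp.out
  have hp0 : (p : ℚ_[p]) ≠ 0 := by exact_mod_cast hpp.ne_zero
  have hNp : N.Coprime p := Nat.Coprime.coprime_mul_right_right hN
  have hNp1 : N.Coprime (p - 1) := Nat.Coprime.coprime_mul_left_right hN
  set w : ℚ_[p] := u * (p : ℚ_[p]) ^ (-(N * s)) with hw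
  have hw1 : ‖w‖ = 1 := by
    rw [hw, norm_mul, Padic.norm_eq_zpow_neg_valuation hu, hs, Padic.norm_p_zpow, neg_neg,
      ← zpow_add₀ (by exact_mod_cast hpp.ne_zero)]
    simp
  let v : ℤ_[p] := ⟨w, hw1.le⟩
  have hv : ‖v‖ = 1 := hw1
  obtain ⟨vu, hvu⟩ := PadicInt.isUnit_iff.2 hv
  have hcard : (Nat.card (ZMod p)ˣ).Coprime N := by
    rw [Nat.card_eq_fintype_card, ZMod.card_units_eq_totient, Nat.totient_prime hpp]
    exact hNp1.symm
  obtain ⟨g, hg⟩ := (powCoprime hcard).surjective (Units.map (PadicInt.toZMod (p := p)) vu)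
  have hg' : ((g : ZMod p)) ^ N = PadicInt.toZMod v := by
    have := congrArg Units.val hg
    simpa [powCoprime, hvu] using this
  obtain ⟨a, ha⟩ := ZMod.intCast_surjective (g : ZMod p)
  have hnorm (x : ℤ_[p]) : ‖x‖ < 1 ↔ PadicInt.toZMod x = 0 := by
    rw [← RingHom.mem_ker, PadicInt.ker_toZMod, IsLocalRing.mem_maximalIdeal, PadicInt.mem_nonunits]
  have hnorm1 (x : ℤ_[p]) : ‖x‖ = 1 ↔ PadicInt.toZMod x ≠ 0 := by
    rw [Ne, ← hnorm, not_lt]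
    exact ⟨fun h => h.ge, fun h => le_antisymm (PadicInt.norm_le_one x) h⟩
  have hder : ‖(N : ℤ_[p]) * (a : ℤ_[p]) ^ (N - 1)‖ = 1 := by
    rw [hnorm1, map_mul, map_pow, map_natCast, map_intCast, ha]
    refine mul_ne_zero ?_ (pow_ne_zero _ g.ne_zero)
    rw [Ne, ZMod.natCast_eq_zero_iff]
    intro h
    exact hpp.one_lt.ne' (Nat.eq_one_of_dvd_coprimes hNp h dvd_rfl)
  obtain ⟨z, hz, -⟩ := hensels_lemma (p := p) (R := ℤ_[p])
    (F := Polynomial.X ^ N - Polynomial.C v) (a := (a : ℤ_[p])) (by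
      have h1 : ‖(a : ℤ_[p]) ^ N - v‖ < 1 := by
        rw [hnorm, map_sub, map_pow, map_intCast, ha, hg', sub_self]
      simpa [Polynomial.derivative_X_pow, hder] using h1)
  have hz' : z ^ N = v := by simpa [sub_eq_zero] using hz
  have hz'' : (z : ℚ_[p]) ^ N = w := by
    have := congrArg (fun x : ℤ_[p] => (x : ℚ_[p])) hz'
    simpa using this
  refine ⟨z * (p : ℚ_[p]) ^ s, ?_⟩
  rw [mul_pow, hz'', hw, mul_assoc, ← zpow_natCast, ← zpow_mul, ← zpow_add₀ hp0]
  simp [mul_comm]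

theorem Int.exists_eq_linear_combination_of_coprime {q1 q2 q3 : ℕ} (h1 : 0 < q1) (h2 : 0 < q2)
    (h3 : 0 < q3) (h12 : q1.Coprime q2) (h13 : q1.Coprime q3) (h23 : q2.Coprime q3)
    (A : ℕ → ℤ) (B : ℕ) (t : ℤ) :
    ∃ j k l : ℕ, ∃ s : ℤ, 1 ≤ j ∧ j ≤ q1 ∧ B ≤ k ∧ B ≤ l ∧
      t = q1 * q2 * (k - j) + q1 * q3 * (A j - l) + q2 * q3 * (q1 + 1 - j) + q1 * q2 * q3 * s := by
  have hc : IsCoprime ((q2 * q3 : ℕ) : ℤ) (q1 : ℤ) :=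
    Nat.isCoprime_iff_coprime.2 (Nat.Coprime.mul_left h12.symm h13.symm)
  obtain ⟨c, d, hcd⟩ := hc
  obtain ⟨u, v, huv⟩ := Nat.isCoprime_iff_coprime.2 h23
  push_cast at hcd
  have hq1 : (0 : ℤ) < q1 := by exact_mod_cast h1
  have hi0 := Int.emod_nonneg (t * c - 1) hq1.ne'
  have hi1 := Int.emod_lt_of_pos (t * c - 1) hq1
  have hdm := Int.emod_add_mul_ediv (t * c - 1) q1
  obtain ⟨i, hi⟩ := Int.eq_ofNat_of_zero_le hi0
  set e := (t * c - 1) / q1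
  rw [hi] at hi1 hdm
  have hiq : i < q1 := by exact_mod_cast hi1
  obtain ⟨j, hj⟩ : ∃ j, j + i = q1 := ⟨q1 - i, by omega⟩
  have hjz : (j : ℤ) + i = q1 := by exact_mod_cast hj
  obtain ⟨t', ht'⟩ : ∃ t', t - q2 * q3 * (i + 1) = q1 * t' := by
    refine ⟨t * d + q2 * q3 * e, ?_⟩
    linear_combination (-t) * hcd + q2 * q3 * (-1) * hdm
  set n1 : ℤ := |j + t' * u| + B with hn1
  set n2 : ℤ := |A j - t' * v| + B with hn2
  have hk : (B : ℤ) ≤ j + t' * u + q3 * n1 := by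
    have := neg_abs_le (j + t' * u)
    have h3' : (1 : ℤ) ≤ q3 := by exact_mod_cast h3
    have : n1 ≤ q3 * n1 := le_mul_of_one_le_left (by positivity) h3'
    omega
  have hl : (B : ℤ) ≤ A j - t' * v + q2 * n2 := by
    have := neg_abs_le (A j - t' * v)
    have h3' : (1 : ℤ) ≤ q2 := by exact_mod_cast h2
    have : n2 ≤ q2 * n2 := le_mul_of_one_le_left (by positivity) h3'
    omega
  obtain ⟨k, hk'⟩ := Int.eq_ofNat_of_zero_le ((Int.natCast_nonneg B).trans hk)
  obtain ⟨l, hl'⟩ := Int.eq_ofNat_of_zero_le ((Int.natCast_nonneg B).trans hl)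
  refine ⟨j, k, l, n2 - n1, by omega, by omega, by omega, by omega, ?_⟩
  rw [← hk', ← hl']
  linear_combination ht' - q1 * t' * huv + q2 * q3 * hjz

/-- The product of the linear factors of multiplicity `q1 * q2`. -/
def formA (p : ℤ) (q3 : ℕ) (a b : ℤ) : ℤ := a * ∏ i ∈ Finset.Icc 1 (q3 - 1), (p ^ i * a + b)

/-- The product of the linear factors of multiplicity `q1 * q3`. -/
def formB (p : ℤ) (q1 q2 q3 : ℕ) (a b : ℤ) : ℤ :=
  (∏ i ∈ Finset.Icc 1 q1, (a + p ^ i * b)) *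
    ∏ i ∈ Finset.Icc q3 (q3 + q2 - q1 - 1), (p ^ i * a + b)

/-- The product of the linear factors of multiplicity `q2 * q3`. -/
def formC (p : ℤ) (q1 q2 q3 : ℕ) (a b : ℤ) : ℤ :=
  (a + p ^ (q1 + 1) * b) * ∏ i ∈ Finset.Icc (q3 + q2 - q1) (q3 + q2 - 2), (p ^ i * a + b)

theorem formA_mul {q3 : ℕ} (h3 : 0 < q3) (p d a b : ℤ) :
    formA p q3 (d * a) (d * b) = d ^ q3 * formA p q3 a b := by
  have h (i : ℕ) : p ^ i * (d * a) + d * b = d * (p ^ i * a + b) := by ring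
  obtain ⟨m, rfl⟩ := Nat.exists_eq_succ_of_ne_zero h3.ne'
  simp only [formA, h, Finset.prod_mul_distrib, Finset.prod_const, Nat.card_Icc]
  simp
  ring

theorem formB_mul {q1 q2 q3 : ℕ} (h12 : q1 < q2) (p d a b : ℤ) :
    formB p q1 q2 q3 (d * a) (d * b) = d ^ q2 * formB p q1 q2 q3 a b := by
  have h (i : ℕ) : p ^ i * (d * a) + d * b = d * (p ^ i * a + b) := by ring
  have h' (i : ℕ) : d * a + p ^ i * (d * b) = d * (a + p ^ i * b) := by ring
  simp only [formB, h, h', Finset.prod_mul_distrib, Finset.prod_const, Nat.card_Icc]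
  rw [show q2 = (q1 + 1 - 1) + (q3 + q2 - q1 - 1 + 1 - q3) by omega, pow_add]
  rw [show (q1 + 1 - 1) + (q3 + q2 - q1 - 1 + 1 - q3) = q2 by omega]
  ring

theorem formC_mul {q1 q2 q3 : ℕ} (h1 : 0 < q1) (h12 : q1 < q2) (p d a b : ℤ) :
    formC p q1 q2 q3 (d * a) (d * b) = d ^ q1 * formC p q1 q2 q3 a b := by
  have h (i : ℕ) : p ^ i * (d * a) + d * b = d * (p ^ i * a + b) := by ring
  have h' (i : ℕ) : d * a + p ^ i * (d * b) = d * (a + p ^ i * b) := by ring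
  simp only [formC, h, h', Finset.prod_mul_distrib, Finset.prod_const, Nat.card_Icc]
  obtain ⟨m, rfl⟩ := Nat.exists_eq_add_one_of_ne_zero h1.ne'
  rw [show q3 + q2 - 2 + 1 - (q3 + q2 - (m + 1)) = m by omega]
  ring

theorem Int.emultiplicity_pow_mul_eq {p : ℤ} (hp : Prime p) {a : ℕ} {c : ℤ} (hc : ¬p ∣ c) :
    emultiplicity p (p ^ a * c) = a := by
  rw [emultiplicity_mul hp, emultiplicity_eq_zero.2 hc, add_zero,
    emultiplicity_pow_self hp.ne_zero hp.not_isUnit]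

theorem Prime.not_dvd_of_isUnit_sub {R : Type*} [CommRing R] {p c u : R} (hp : Prime p)
    (hu : IsUnit u) (h : p ∣ c - u) : ¬p ∣ c := fun hc =>
  hp.not_isUnit (isUnit_of_dvd_unit ((dvd_sub_right hc).1 h) hu)

theorem emultiplicity_prod_pow_mul_add_one {p x : ℤ} (hp : Prime p) (hx : p ∣ x)
    (s : Finset ℕ) : emultiplicity p (∏ i ∈ s, (p ^ i * x + 1)) = 0 := by
  rw [Finset.emultiplicity_prod hp]
  refine Finset.sum_eq_zero fun i _ => emultiplicity_eq_zero.2 ?_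
  refine hp.not_dvd_of_isUnit_sub isUnit_one ?_
  simpa using hx.mul_left _

theorem emultiplicity_pow_add_pow {p : ℤ} (hp : Prime p) {k i : ℕ} (h : i < k) :
    emultiplicity p (p ^ k + p ^ i) = i := by
  obtain ⟨d, rfl⟩ := Nat.exists_eq_add_of_lt h
  rw [show p ^ (i + d + 1) + p ^ i = p ^ i * (p ^ (d + 1) + 1) by ring]
  refine Int.emultiplicity_pow_mul_eq hp (hp.not_dvd_of_isUnit_sub isUnit_one ?_)
  simp [pow_succ]

theorem emultiplicity_pow_sub_pow {p : ℤ} (hp : Prime p) {k i : ℕ} (h : i < k) :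
    emultiplicity p (p ^ k - p ^ i) = i := by
  obtain ⟨d, rfl⟩ := Nat.exists_eq_add_of_lt h
  rw [show p ^ (i + d + 1) - p ^ i = p ^ i * (p ^ (d + 1) - 1) by ring]
  refine Int.emultiplicity_pow_mul_eq hp (hp.not_dvd_of_isUnit_sub (u := -1) (by simp) ?_)
  simp [pow_succ]

theorem emultiplicity_pow_sub_pow_add_pow {p : ℤ} (hp : Prime p) {l i j : ℕ} (hij : i ≠ j)
    (hi : i < l) (hj : j < l) : emultiplicity p (p ^ l - p ^ j + p ^ i) = (min i j : ℕ) := by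
  rcases lt_or_gt_of_ne hij with h | h
  · obtain ⟨d, rfl⟩ := Nat.exists_eq_add_of_lt h
    obtain ⟨e, rfl⟩ := Nat.exists_eq_add_of_lt hi
    rw [min_eq_left h.le, show p ^ (i + e + 1) - p ^ (i + d + 1) + p ^ i =
      p ^ i * (p ^ (e + 1) - p ^ (d + 1) + 1) by ring]
    refine Int.emultiplicity_pow_mul_eq hp (hp.not_dvd_of_isUnit_sub isUnit_one ?_)
    rw [add_sub_cancel_right]
    exact dvd_sub (dvd_pow_self _ (by omega)) (dvd_pow_self _ (by omega))
  · obtain ⟨d, rfl⟩ := Nat.exists_eq_add_of_lt h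
    obtain ⟨e, rfl⟩ := Nat.exists_eq_add_of_lt hj
    rw [min_eq_right h.le, show p ^ (j + e + 1) - p ^ j + p ^ (j + d + 1) =
      p ^ j * (p ^ (e + 1) - 1 + p ^ (d + 1)) by ring]
    refine Int.emultiplicity_pow_mul_eq hp (hp.not_dvd_of_isUnit_sub (u := -1) (by simp) ?_)
    rw [show p ^ (e + 1) - 1 + p ^ (d + 1) - -1 = p ^ (e + 1) + p ^ (d + 1) by ring]
    exact dvd_add (dvd_pow_self _ (by omega)) (dvd_pow_self _ (by omega))

/-- The values of the binary form `g₂`. -/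
def binaryForm (p : ℤ) (q1 q2 q3 : ℕ) (a b : ℤ) : ℤ :=
  formA p q3 a b ^ (q1 * q2) * formB p q1 q2 q3 a b ^ (q1 * q3) * formC p q1 q2 q3 a b ^ (q2 * q3)

theorem emultiplicity_binaryForm_pow {p : ℤ} (hp : Prime p) {q1 q2 q3 k : ℕ} (hk : q1 + 2 ≤ k) :
    emultiplicity p (binaryForm p q1 q2 q3 (p ^ k) 1) =
      (q1 * q2 * k + q1 * q3 * ∑ i ∈ Finset.Icc 1 q1, i + q2 * q3 * (q1 + 1) : ℕ) := by
  have hx : p ∣ p ^ k := dvd_pow_self _ (by omega)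
  have hB : emultiplicity p (∏ i ∈ Finset.Icc 1 q1, (p ^ k + p ^ i)) =
      (∑ i ∈ Finset.Icc 1 q1, i : ℕ) := by
    rw [Finset.emultiplicity_prod hp, Nat.cast_sum]
    refine Finset.sum_congr rfl fun i hi => emultiplicity_pow_add_pow hp ?_
    have := (Finset.mem_Icc.1 hi).2
    omega
  simp only [binaryForm, formA, formB, formC, emultiplicity_mul hp, emultiplicity_pow hp,
    emultiplicity_prod_pow_mul_add_one hp hx, mul_one, hB,
    emultiplicity_pow_add_pow hp (show q1 + 1 < k by omega), add_zero,
    (FiniteMultiplicity.of_prime_left hp hp.ne_zero).emultiplicity_self]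
  push_cast
  ring

theorem emultiplicity_binaryForm_pow_sub_pow {p : ℤ} (hp : Prime p) {q1 q2 q3 l j : ℕ}
    (hj : 1 ≤ j) (hj' : j ≤ q1) (hl : q1 + 2 ≤ l) :
    emultiplicity p (binaryForm p q1 q2 q3 (p ^ l - p ^ j) 1) =
      (q1 * q2 * j + q1 * q3 * (l + ∑ i ∈ (Finset.Icc 1 q1).erase j, min i j) + q2 * q3 * j : ℕ) := by
  have hx : p ∣ p ^ l - p ^ j := dvd_sub (dvd_pow_self _ (by omega)) (dvd_pow_self _ (by omega))
  have hB : emultiplicity p (∏ i ∈ Finset.Icc 1 q1, (p ^ l - p ^ j + p ^ i)) =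
      (l + ∑ i ∈ (Finset.Icc 1 q1).erase j, min i j : ℕ) := by
    rw [Finset.emultiplicity_prod hp, ← Finset.add_sum_erase _ _ (Finset.mem_Icc.2 ⟨hj, hj'⟩),
      sub_add_cancel, emultiplicity_pow_self hp.ne_zero hp.not_isUnit, Nat.cast_add, Nat.cast_sum]
    congr 1
    refine Finset.sum_congr rfl fun i hi => ?_
    have h1 := Finset.ne_of_mem_erase hi
    have h2 := (Finset.mem_Icc.1 (Finset.mem_of_mem_erase hi)).2
    exact emultiplicity_pow_sub_pow_add_pow hp h1 (by omega) (by omega)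
  have hC : emultiplicity p (p ^ l - p ^ j + p ^ (q1 + 1)) = j := by
    rw [emultiplicity_pow_sub_pow_add_pow hp (by omega) (by omega) (by omega),
      min_eq_right (by omega)]
  simp only [binaryForm, formA, formB, formC, emultiplicity_mul hp, emultiplicity_pow hp,
    emultiplicity_prod_pow_mul_add_one hp hx, mul_one, hB, hC, add_zero,
    emultiplicity_pow_sub_pow hp (show j < l by omega)]
  push_cast
  ring

theorem Padic.valuation_intCast_of_emultiplicity_eq {p : ℕ} [Fact p.Prime] {z : ℤ} {a : ℕ}
    (h : emultiplicity (p : ℤ) z = a) : z ≠ 0 ∧ (z : ℚ_[p]).valuation = a := by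
  refine ⟨?_, ?_⟩
  · rintro rfl
    simp at h
  · rw [Padic.valuation_intCast, padicValInt, padicValNat_def']
    · rw [← multiplicity_eq_of_emultiplicity_eq_some h, ← Int.multiplicity_natAbs]
    · exact (Fact.out : p.Prime).ne_one
    · intro h0
      rw [Int.natAbs_eq_zero.1 h0] at h
      simp at h

/-- If `F` takes all values `f a b * w ^ N` and the valuations of the ratios of values of `f` cover
all residues modulo `N`, then the ratio set of `F` is dense. -/
theorem dense_ratioSet_of_binary {p : ℕ} [Fact p.Prime] {n N : ℕ} {F : MvPolynomial (Fin n) ℤ}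
    (hN : N.Coprime (p * (p - 1))) (f : ℤ → ℤ → ℤ)
    (hF : ∀ a b w : ℤ, ∃ x, eval x F = f a b * w ^ N)
    (hval : ∀ t : ℤ, ∃ a b c d : ℤ, f a b ≠ 0 ∧ f c d ≠ 0 ∧
      ∃ s : ℤ, t = (f a b : ℚ_[p]).valuation - (f c d : ℚ_[p]).valuation + N * s) :
    Dense (ratioSet p F) := by
  intro t
  obtain ⟨a, b, c, d, hab, hcd, s, hs⟩ := hval t.valuation
  have hab' : (f a b : ℚ_[p]) ≠ 0 := by exact_mod_cast hab
  have hcd' : (f c d : ℚ_[p]) ≠ 0 := by exact_mod_cast hcd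
  obtain ⟨r, hr⟩ : ∃ r : ℚ_[p], (f a b : ℚ_[p]) / f c d * r ^ N = t := by
    by_cases ht : t = 0
    · refine ⟨0, ?_⟩
      have : N ≠ 0 := by
        rintro rfl
        have hp := (Fact.out : p.Prime).two_le
        rw [Nat.coprime_zero_left] at hN
        have := Nat.dvd_one.1 (hN ▸ dvd_mul_right p (p - 1))
        omega
      simp [ht, this]
    · have hu : t * (f a b : ℚ_[p])⁻¹ * f c d ≠ 0 := by positivity
      obtain ⟨r, hr⟩ := Padic.exists_pow_eq_of_valuation hN hu (s := s) (by
        rw [Padic.valuation_mul (by positivity) hcd', Padic.valuation_mul ht (by positivity),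
          Padic.valuation_inv, hs]
        ring)
      exact ⟨r, by rw [hr]; field_simp⟩
  rw [← hr]
  have hcont : Continuous fun z : ℚ_[p] => (f a b : ℚ_[p]) / f c d * z ^ N := by fun_prop
  refine closure_mono ?_
    (hcont.range_subset_closure_image_dense (Padic.denseRange_ratCast p) ⟨r, rfl⟩)
  rintro _ ⟨_, ⟨z, rfl⟩, rfl⟩
  obtain ⟨x, hx⟩ := hF a b z.num
  obtain ⟨y, hy⟩ := hF c d z.den
  have hz : (z.den : ℤ) ≠ 0 := by exact_mod_cast z.den_ne_zero
  refine ⟨x, y, by rw [hy]; exact mul_ne_zero hcd (pow_ne_zero _ hz), ?_⟩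
  rw [hx, hy]
  beta_reduce
  rw [Rat.cast_def]
  push_cast
  rw [div_pow, div_mul_div_comm]

theorem dvd_valuation_of_eq_pow_mul {q : ℕ} [Fact q.Prime] {m : ℕ} {z c e : ℤ}
    (hz : z ≠ 0) (h : z = c ^ m * e) (he : ¬(q : ℤ) ∣ e) :
    (m : ℤ) ∣ (z : ℚ_[q]).valuation := by
  have hc : c ^ m ≠ 0 := by rintro h0; simp [h, h0] at hz
  have he' : e ≠ 0 := by rintro rfl; simp at he
  have hv : (e : ℚ_[q]).valuation = 0 := by
    rw [Padic.valuation_intCast, padicValInt.eq_zero_of_not_dvd he, Nat.cast_zero]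
  rw [h, Int.cast_mul, Padic.valuation_mul (by exact_mod_cast hc) (by exact_mod_cast he'), hv,
    add_zero, Int.cast_pow, Padic.valuation_pow]
  exact dvd_mul_right _ _

theorem not_dense_ratioSet_of_valuation_ne {q : ℕ} [Fact q.Prime] {n : ℕ}
    {F : MvPolynomial (Fin n) ℤ}
    (h : ∀ x y, eval x F ≠ 0 → eval y F ≠ 0 →
      (eval x F : ℚ_[q]).valuation - (eval y F : ℚ_[q]).valuation ≠ 1) :
    ¬Dense (ratioSet q F) := by
  intro hd
  have hq0 : (q : ℚ_[q]) ≠ 0 := by exact_mod_cast (Fact.out : q.Prime).ne_zero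
  obtain ⟨_, ⟨x, y, hy, rfl⟩, hxy⟩ := hd.exists_dist_lt (q : ℚ_[q]) (norm_pos_iff.2 hq0)
  rw [dist_comm, dist_eq_norm] at hxy
  have hn := Padic.norm_eq_of_norm_sub_lt_right hxy
  have hne : (eval x F : ℚ_[q]) / eval y F ≠ 0 := by
    rw [← norm_ne_zero_iff, hn]
    exact norm_ne_zero_iff.2 hq0
  have hx : (eval x F : ℚ_[q]) ≠ 0 := fun h0 => hne (by rw [h0, zero_div])
  have hy' : (eval y F : ℚ_[q]) ≠ 0 := by exact_mod_cast hy
  refine h x y (by exact_mod_cast hx) hy ?_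
  rw [Padic.norm_eq_zpow_neg_valuation hne, Padic.norm_eq_zpow_neg_valuation hq0,
    Padic.valuation_p, div_eq_mul_inv, Padic.valuation_mul hx (inv_ne_zero hy'),
    Padic.valuation_inv] at hn
  have := zpow_right_injective₀ (by exact_mod_cast (Fact.out : q.Prime).pos)
    (by exact_mod_cast (Fact.out : q.Prime).ne_one) hn
  omega

/-- A common root modulo `q` of two distinct members of the pencil forces both coordinates to
vanish modulo `q`. -/
theorem eq_of_dvd_of_dvd {p q : ℕ} (hp : p.Prime) (hq : q.Prime) {M K e e' : ℕ} (hpq : p ^ M < q)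
    {a b : ℤ} (hab : IsCoprime a b) (he : e ≤ M) (he' : e' ≤ M)
    (h : (q : ℤ) ∣ p ^ K * a + p ^ e * b) (h' : (q : ℤ) ∣ p ^ K * a + p ^ e' * b)
    (hqp : ¬(q : ℤ) ∣ p) : e = e' := by
  have hqz := Nat.prime_iff_prime_int.1 hq
  wlog hlt : e ≤ e' generalizing e e'
  · exact (this he' he h' h (le_of_not_ge hlt)).symm
  obtain ⟨d, rfl⟩ := Nat.exists_eq_add_of_le hlt
  by_contra hd
  have hd0 : d ≠ 0 := by omega
  have hsub : (q : ℤ) ∣ (p : ℤ) ^ e * (((p : ℤ) ^ d - 1) * b) := by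
    have := dvd_sub h' h
    rwa [show (p : ℤ) ^ e * (((p : ℤ) ^ d - 1) * b) = p ^ K * a + p ^ (e + d) * b -
      (p ^ K * a + p ^ e * b) by ring]
  have hpd : ¬(q : ℤ) ∣ (p : ℤ) ^ d - 1 := by
    intro hdvd
    have h1 : 1 < p ^ d := Nat.one_lt_pow hd0 hp.one_lt
    have h2 : p ^ d ≤ p ^ M := Nat.pow_le_pow_right hp.pos (by omega)
    rw [← Nat.cast_pow] at hdvd
    have := Int.le_of_dvd (by omega) hdvd
    omega
  have hb : (q : ℤ) ∣ b := (hqz.dvd_or_dvd ((hqz.dvd_or_dvd hsub).resolve_left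
    fun h => hqp (hqz.dvd_of_dvd_pow h))).resolve_left hpd
  have ha : (q : ℤ) ∣ a := (hqz.dvd_or_dvd ((dvd_add_left (hb.mul_left _)).1 h)).resolve_left
    fun h => hqp (hqz.dvd_of_dvd_pow h)
  exact hqz.not_isUnit (hab.isUnit_of_dvd' ha hb)

theorem not_dvd_of_dvd {p q : ℕ} (hq : q.Prime) {K e : ℕ} {a b : ℤ} (hab : IsCoprime a b)
    (hqp : ¬(q : ℤ) ∣ p) (ha : (q : ℤ) ∣ a) : ¬(q : ℤ) ∣ p ^ K * a + p ^ e * b := by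
  intro h
  have hqz := Nat.prime_iff_prime_int.1 hq
  have hb : (q : ℤ) ∣ b := (hqz.dvd_or_dvd ((dvd_add_right (ha.mul_left _)).1 h)).resolve_left
    fun h => hqp (hqz.dvd_of_dvd_pow h)
  exact hqz.not_isUnit (hab.isUnit_of_dvd' ha hb)

theorem exists_dvd_of_dvd_prod {p q : ℤ} (hq : Prime q) {K u v : ℕ} (hv : v ≤ K) {a b : ℤ}
    (h : q ∣ ∏ i ∈ Finset.Icc u v, (p ^ i * a + b)) :
    ∃ e, e + u ≤ K ∧ K ≤ e + v ∧ q ∣ p ^ K * a + p ^ e * b := by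
  obtain ⟨i, hi, hdvd⟩ := (hq.dvd_finsetProd_iff _).1 h
  obtain ⟨hu, hiv⟩ := Finset.mem_Icc.1 hi
  obtain ⟨e, rfl⟩ := Nat.exists_eq_add_of_le' (hiv.trans hv)
  refine ⟨e, by omega, by omega, ?_⟩
  rw [show p ^ (e + i) * a + p ^ e * b = p ^ e * (p ^ i * a + b) by ring]
  exact hdvd.mul_left _

theorem dvd_of_dvd_add_pow {p q : ℤ} (K : ℕ) {i : ℕ} {a b : ℤ} (h : q ∣ a + p ^ i * b) :
    q ∣ p ^ K * a + p ^ (K + i) * b := by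
  rw [show p ^ K * a + p ^ (K + i) * b = p ^ K * (a + p ^ i * b) by ring]
  exact h.mul_left _

theorem exists_root_of_dvd_formA {p q : ℤ} (hq : Prime q) {q2 q3 : ℕ} (h2 : 2 ≤ q2)
    {a b : ℤ} (h : q ∣ formA p q3 a b) :
    q ∣ a ∨ ∃ e, q2 ≤ e + 1 ∧ e + 1 ≤ q3 + q2 - 2 ∧ q ∣ p ^ (q3 + q2 - 2) * a + p ^ e * b := by
  refine (hq.dvd_or_dvd h).imp_right fun h => ?_
  obtain ⟨e, h1, h2, h3⟩ := exists_dvd_of_dvd_prod (K := q3 + q2 - 2) hq (by omega) h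
  exact ⟨e, by omega, by omega, h3⟩

theorem exists_root_of_dvd_formB {p q : ℤ} (hq : Prime q) {q1 q2 q3 : ℕ} (h1 : 2 ≤ q1)
    (h12 : q1 < q2) {a b : ℤ} (h : q ∣ formB p q1 q2 q3 a b) :
    ∃ e, (q3 + q2 - 2 < e ∧ e ≤ q3 + q2 - 2 + q1 ∨ q1 ≤ e + 1 ∧ e + 2 ≤ q2) ∧
      q ∣ p ^ (q3 + q2 - 2) * a + p ^ e * b := by
  rcases hq.dvd_or_dvd h with h | h
  · obtain ⟨i, hi, hdvd⟩ := (hq.dvd_finsetProd_iff _).1 h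
    obtain ⟨hi1, hi2⟩ := Finset.mem_Icc.1 hi
    exact ⟨_, Or.inl (by omega), dvd_of_dvd_add_pow _ hdvd⟩
  · obtain ⟨e, h1, h2, h3⟩ := exists_dvd_of_dvd_prod (K := q3 + q2 - 2) hq (by omega) h
    exact ⟨e, Or.inr (by omega), h3⟩

theorem exists_root_of_dvd_formC {p q : ℤ} (hq : Prime q) {q1 q2 q3 : ℕ}
    (h12 : q1 < q2) {a b : ℤ} (h : q ∣ formC p q1 q2 q3 a b) :
    ∃ e, (e = q3 + q2 - 2 + (q1 + 1) ∨ e + 2 ≤ q1) ∧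
      q ∣ p ^ (q3 + q2 - 2) * a + p ^ e * b := by
  rcases hq.dvd_or_dvd h with h | h
  · exact ⟨_, Or.inl rfl, dvd_of_dvd_add_pow _ h⟩
  · obtain ⟨e, h1, h2, h3⟩ := exists_dvd_of_dvd_prod (K := q3 + q2 - 2) hq (by omega) h
    exact ⟨e, Or.inr (by omega), h3⟩

theorem not_dvd_forms {p q : ℕ} (hp : p.Prime) (hq : q.Prime) {q1 q2 q3 : ℕ} (h1 : 2 ≤ q1)
    (h12 : q1 < q2) (h23 : q2 < q3) (hpq : p ^ (q1 + q2 + q3 - 1) < q) {a b : ℤ}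
    (hab : IsCoprime a b) :
    (¬(q : ℤ) ∣ formA p q3 a b ∧ ¬(q : ℤ) ∣ formB p q1 q2 q3 a b) ∨
    (¬(q : ℤ) ∣ formA p q3 a b ∧ ¬(q : ℤ) ∣ formC p q1 q2 q3 a b) ∨
    (¬(q : ℤ) ∣ formB p q1 q2 q3 a b ∧ ¬(q : ℤ) ∣ formC p q1 q2 q3 a b) := by
  have hqz := Nat.prime_iff_prime_int.1 hq
  have hqp : ¬(q : ℤ) ∣ p := by
    rw [Int.natCast_dvd_natCast]
    intro h
    have := Nat.le_of_dvd hp.pos h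
    have : p ≤ p ^ (q1 + q2 + q3 - 1) := Nat.le_self_pow (by omega) p
    omega
  have hAB (hA : (q : ℤ) ∣ formA p q3 a b) (hB : (q : ℤ) ∣ formB p q1 q2 q3 a b) : False := by
    obtain ⟨e, he, hdvd⟩ := exists_root_of_dvd_formB hqz h1 h12 hB
    rcases exists_root_of_dvd_formA hqz (q2 := q2) (by omega) hA with ha | ⟨e', he1, he2, hdvd'⟩
    · exact not_dvd_of_dvd hq hab hqp ha hdvd
    · have := eq_of_dvd_of_dvd hp hq hpq hab (by omega) (by omega) hdvd hdvd' hqp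
      omega
  have hAC (hA : (q : ℤ) ∣ formA p q3 a b) (hC : (q : ℤ) ∣ formC p q1 q2 q3 a b) : False := by
    obtain ⟨e, he, hdvd⟩ := exists_root_of_dvd_formC hqz h12 hC
    rcases exists_root_of_dvd_formA hqz (q2 := q2) (by omega) hA with ha | ⟨e', he1, he2, hdvd'⟩
    · exact not_dvd_of_dvd hq hab hqp ha hdvd
    · have := eq_of_dvd_of_dvd hp hq hpq hab (by omega) (by omega) hdvd hdvd' hqp
      omega
  have hBC (hB : (q : ℤ) ∣ formB p q1 q2 q3 a b) (hC : (q : ℤ) ∣ formC p q1 q2 q3 a b) :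
      False := by
    obtain ⟨e, he, hdvd⟩ := exists_root_of_dvd_formB hqz h1 h12 hB
    obtain ⟨e', he', hdvd'⟩ := exists_root_of_dvd_formC hqz h12 hC
    have := eq_of_dvd_of_dvd hp hq hpq hab (by omega) (by omega) hdvd hdvd' hqp
    omega
  tauto

theorem dvd_valuation_binaryForm_mul_pow {p q : ℕ} (hp : p.Prime) [hq : Fact q.Prime]
    {q1 q2 q3 : ℕ} (h1 : 2 ≤ q1) (h12 : q1 < q2) (h23 : q2 < q3)
    (hpq : p ^ (q1 + q2 + q3 - 1) < q) {a b w : ℤ}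
    (hne : binaryForm p q1 q2 q3 a b * w ^ (q1 * q2 * q3) ≠ 0) :
    let v := ((binaryForm p q1 q2 q3 a b * w ^ (q1 * q2 * q3) : ℤ) : ℚ_[q]).valuation
    ((q1 * q2 : ℕ) : ℤ) ∣ v ∨ ((q1 * q3 : ℕ) : ℤ) ∣ v ∨ ((q2 * q3 : ℕ) : ℤ) ∣ v := by
  intro v
  have hqz := Nat.prime_iff_prime_int.1 hq.out
  obtain ⟨d, a', b', hab, rfl, rfl⟩ : ∃ d a' b' : ℤ, IsCoprime a' b' ∧ a = d * a' ∧ b = d * b' := by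
    have h0 : 0 < Int.gcd a b := by
      rw [Int.gcd_pos_iff]
      by_contra! h
      apply hne
      have : q1 * q2 ≠ 0 := mul_ne_zero (by omega) (by omega)
      simp [binaryForm, formA, h.1, this]
    obtain ⟨a', b', h, ha, hb⟩ := Int.exists_gcd_one h0
    exact ⟨_, a', b', Int.isCoprime_iff_gcd_eq_one.2 h, by rw [mul_comm]; exact ha,
      by rw [mul_comm]; exact hb⟩
  have hform : binaryForm p q1 q2 q3 (d * a') (d * b') =
      d ^ (3 * (q1 * q2 * q3)) * binaryForm p q1 q2 q3 a' b' := by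
    simp only [binaryForm, formA_mul (show 0 < q3 by omega), formB_mul h12,
      formC_mul (show 0 < q1 by omega) h12]
    ring
  have key {m k : ℕ} (hmk : q1 * q2 * q3 = k * m) {A e : ℤ} (he : ¬(q : ℤ) ∣ e)
      (hA : binaryForm p q1 q2 q3 a' b' = A ^ m * e) : (m : ℤ) ∣ v := by
    refine dvd_valuation_of_eq_pow_mul (c := d ^ (3 * k) * A * w ^ k) (e := e) hne ?_ he
    rw [hform, hA, hmk]
    ring
  have hmul {x y : ℤ} {i j : ℕ} (hx : ¬(q : ℤ) ∣ x) (hy : ¬(q : ℤ) ∣ y) :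
      ¬(q : ℤ) ∣ x ^ i * y ^ j := fun h =>
    (hqz.dvd_or_dvd h).elim (fun h => hx (hqz.dvd_of_dvd_pow h)) fun h => hy (hqz.dvd_of_dvd_pow h)
  rcases not_dvd_forms hp hq.out h1 h12 h23 hpq hab with ⟨hx, hy⟩ | ⟨hx, hy⟩ | ⟨hx, hy⟩
  · exact Or.inr (Or.inr (key (k := q1) (by ring) (hmul hx hy)
      (by rw [binaryForm, mul_comm])))
  · exact Or.inr (Or.inl (key (k := q2) (by ring) (hmul hx hy)
      (by rw [binaryForm, mul_comm (formA _ _ _ _ ^ _), mul_assoc])))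
  · exact Or.inl (key (k := q3) (by ring) (hmul hx hy) (by rw [binaryForm, mul_assoc]))

theorem exists_valuation_binaryForm {p q1 q2 q3 : ℕ} [hp : Fact p.Prime] (h1 : q1.Prime)
    (h2 : q2.Prime) (h3 : q3.Prime) (h12 : q1 < q2) (h23 : q2 < q3) (t : ℤ) :
    ∃ a b c d : ℤ, binaryForm p q1 q2 q3 a b ≠ 0 ∧ binaryForm p q1 q2 q3 c d ≠ 0 ∧
      ∃ s : ℤ, t = (binaryForm p q1 q2 q3 a b : ℚ_[p]).valuation -
        (binaryForm p q1 q2 q3 c d : ℚ_[p]).valuation + (q1 * q2 * q3 : ℕ) * s := by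
  have hpz := Nat.prime_iff_prime_int.1 hp.out
  obtain ⟨j, k, l, s, hj, hj', hk, hl, h⟩ := Int.exists_eq_linear_combination_of_coprime h1.pos
    h2.pos h3.pos ((Nat.coprime_primes h1 h2).2 (by omega)) ((Nat.coprime_primes h1 h3).2 (by omega))
    ((Nat.coprime_primes h2 h3).2 (by omega))
    (fun j => ((∑ i ∈ Finset.Icc 1 q1, i : ℕ) : ℤ) -
      (∑ i ∈ (Finset.Icc 1 q1).erase j, min i j : ℕ)) (q1 + 2) t
  obtain ⟨ha, hav⟩ := Padic.valuation_intCast_of_emultiplicity_eq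
    (emultiplicity_binaryForm_pow (q2 := q2) (q3 := q3) hpz hk)
  obtain ⟨hc, hcv⟩ := Padic.valuation_intCast_of_emultiplicity_eq
    (emultiplicity_binaryForm_pow_sub_pow (q2 := q2) (q3 := q3) hpz hj hj' hl)
  refine ⟨_, _, _, _, ha, hc, s, ?_⟩
  rw [hav, hcv, h]
  push_cast
  ring

theorem sub_ne_one_of_dvd {q1 q2 q3 : ℕ} (h1 : 1 < q1) (h2 : 1 < q2) (h3 : 1 < q3) {v w : ℤ}
    (hv : ((q1 * q2 : ℕ) : ℤ) ∣ v ∨ ((q1 * q3 : ℕ) : ℤ) ∣ v ∨ ((q2 * q3 : ℕ) : ℤ) ∣ v)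
    (hw : ((q1 * q2 : ℕ) : ℤ) ∣ w ∨ ((q1 * q3 : ℕ) : ℤ) ∣ w ∨ ((q2 * q3 : ℕ) : ℤ) ∣ w) :
    v - w ≠ 1 := by
  have key {q : ℕ} (hq : 1 < q) (hv : (q : ℤ) ∣ v) (hw : (q : ℤ) ∣ w) : v - w ≠ 1 := by
    intro h
    have := Int.le_of_dvd one_pos (h ▸ dvd_sub hv hw)
    omega
  push_cast at hv hw
  rcases hv with hv | hv | hv <;> rcases hw with hw | hw | hw <;>
  first
  | exact key h1 (dvd_of_mul_right_dvd hv) (dvd_of_mul_right_dvd hw)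
  | exact key h2 (dvd_of_mul_right_dvd hv) (dvd_of_mul_right_dvd hw)
  | exact key h2 (dvd_of_mul_right_dvd hv) (dvd_of_mul_left_dvd hw)
  | exact key h2 (dvd_of_mul_left_dvd hv) (dvd_of_mul_right_dvd hw)
  | exact key h3 (dvd_of_mul_left_dvd hv) (dvd_of_mul_left_dvd hw)

/-- Let `p` be a prime and `q₁ < q₂ < q₃` primes with `q₁q₂q₃` coprime to `p(p-1)`. For the
binary form `g₂` of the paper and, for `n > 2`, the form
`g_n(x_1,…,x_n) = g₂(x_1,x_2)·(x_3⋯x_n)^{q₁q₂q₃}`, the set `R(g_n)` is dense in `ℚ_p`,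
but not dense in `ℚ_q` for every prime `q > p^{q₁+q₂+q₃-1}`. -/
theorem stmt9 (p q1 q2 q3 : ℕ) [Fact p.Prime]
    (h1 : q1.Prime) (h2 : q2.Prime) (h3 : q3.Prime)
    (h12 : q1 < q2) (h23 : q2 < q3)
    (hcop : Nat.Coprime (q1 * q2 * q3) (p * (p - 1)))
    (g2 : MvPolynomial (Fin 2) ℤ)
    (hg2 : g2 = X 0 ^ (q1 * q2) *
      (∏ i ∈ Finset.Icc 1 q1, (X 0 + C ((p : ℤ) ^ i) * X 1) ^ (q1 * q3)) *
      (X 0 + C ((p : ℤ) ^ (q1 + 1)) * X 1) ^ (q2 * q3) *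
      (∏ i ∈ Finset.Icc 1 (q3 - 1), (C ((p : ℤ) ^ i) * X 0 + X 1) ^ (q1 * q2)) *
      (∏ i ∈ Finset.Icc q3 (q3 + q2 - q1 - 1), (C ((p : ℤ) ^ i) * X 0 + X 1) ^ (q1 * q3)) *
      (∏ i ∈ Finset.Icc (q3 + q2 - q1) (q3 + q2 - 2), (C ((p : ℤ) ^ i) * X 0 + X 1) ^ (q2 * q3)))
    (n : ℕ) (hn : 2 < n)
    (gn : MvPolynomial (Fin n) ℤ)
    (hgn : gn = MvPolynomial.rename (Fin.castLE (by omega : 2 ≤ n)) g2 *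
      ∏ i ∈ Finset.univ.filter (fun i : Fin n => 2 ≤ (i : ℕ)), X i ^ (q1 * q2 * q3)) :
    Dense (ratioSet p gn) ∧
    ∀ q : ℕ, ∀ _ : Fact q.Prime, p ^ (q1 + q2 + q3 - 1) < q → ¬ Dense (ratioSet q gn) := by
  have hp := (Fact.out : p.Prime)
  have heval (x : Fin n → ℤ) : eval x gn =
      binaryForm p q1 q2 q3 (x ⟨0, by omega⟩) (x ⟨1, by omega⟩) *
        (∏ i ∈ Finset.univ.filter (fun i : Fin n => 2 ≤ (i : ℕ)), x i) ^ (q1 * q2 * q3) := by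
    rw [hgn, map_mul, eval_rename, hg2, map_prod, ← Finset.prod_pow]
    simp only [map_mul, map_add, map_pow, map_prod, eval_X, eval_C, Function.comp_apply,
      binaryForm, formA, formB, formC, mul_pow, Finset.prod_pow]
    have h0 : Fin.castLE (by omega : 2 ≤ n) 0 = ⟨0, by omega⟩ := rfl
    have h1 : Fin.castLE (by omega : 2 ≤ n) 1 = ⟨1, by omega⟩ := rfl
    rw [h0, h1]
    ring
  refine ⟨?_, fun q hq hpq => ?_⟩
  · refine dense_ratioSet_of_binary hcop (binaryForm p q1 q2 q3) (fun a b w => ?_)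
      (exists_valuation_binaryForm h1 h2 h3 h12 h23)
    refine ⟨fun i => if (i : ℕ) = 0 then a else if (i : ℕ) = 1 then b else
      if (i : ℕ) = 2 then w else 1, ?_⟩
    rw [heval]
    congr 2
    rw [Finset.prod_eq_single (⟨2, hn⟩ : Fin n)]
    · simp
    · intro i hi hi2
      have hi' : 2 ≤ (i : ℕ) := by simpa using hi
      have : (i : ℕ) ≠ 2 := fun h => hi2 (Fin.ext h)
      simp [this, show (i : ℕ) ≠ 0 by omega, show (i : ℕ) ≠ 1 by omega]
    · simp
  · refine not_dense_ratioSet_of_valuation_ne fun x y hx hy => ?_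
    rw [heval] at hx hy ⊢
    rw [heval]
    exact sub_ne_one_of_dvd h1.one_lt h2.one_lt h3.one_lt
      (dvd_valuation_binaryForm_mul_pow hp h1.two_le h12 h23 hpq hx)
      (dvd_valuation_binaryForm_mul_pow hp h1.two_le h12 h23 hpq hy)
end

section
/- Let F(x,y) = ax^3 + bx^2y + cxy^2 + dy^3 be a primitive integral binary cubic form (the gcd of a,b,c,d is 1) and set D = a^2b^2c^2 − 4a^3c^3 − 4a^2b^3d − 27a^4d^2 + 18a^3bcd. Let p be a prime. (1) If a = 0 and (b,c) ≠ (0,0), then R(F) is dense in ℚ_p. (2) If a ≠ 0, p > 3, and D is not a quadratic residue modulo p (the Legendre symbol (D/p) = −1), then R(F) is dense in ℚ_p. -/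
open MvPolynomial

open Polynomial in
/-- Strong form of Hensel lifting: near an approximate simple root, a polynomial takes all
sufficiently small `p`-adic values. -/
theorem exists_aeval_eq_of_norm_lt {p : ℕ} [Fact p.Prime] (g : ℤ[X]) (t : ℤ_[p])
    (ht : ‖aeval t g‖ < ‖aeval t (derivative g)‖ ^ 2) (w : ℤ_[p])
    (hw : ‖w‖ < ‖aeval t (derivative g)‖ ^ 2) : ∃ z : ℤ_[p], aeval z g = w := by
  have hval (z : ℤ_[p]) :
      aeval z (g.map (Int.castRingHom ℤ_[p]) - Polynomial.C w) = aeval z g - w := by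
    simp [Polynomial.aeval_def, Polynomial.eval₂_eq_eval_map]
  have hder : aeval t (derivative (g.map (Int.castRingHom ℤ_[p]) - Polynomial.C w)) =
      aeval t (derivative g) := by
    simp [Polynomial.aeval_def, Polynomial.eval₂_eq_eval_map, Polynomial.derivative_map]
  obtain ⟨z, hz, -⟩ := hensels_lemma (p := p)
    (F := g.map (Int.castRingHom ℤ_[p]) - Polynomial.C w) (a := t) (by
      rw [hval, hder]
      rw [sub_eq_add_neg]
      exact (PadicInt.nonarchimedean _ _).trans_lt (max_lt ht (by rwa [norm_neg])))
  exact ⟨z, sub_eq_zero.mp (hval z ▸ hz)⟩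

open Polynomial in
/-- The ratios of values of an integral polynomial with an approximate simple root in `ℤ_[p]` are
dense in `ℚ_[p]`. -/
theorem dense_ratio_of_norm_lt {p : ℕ} [Fact p.Prime] (g : ℤ[X]) (t : ℤ_[p])
    (ht : ‖aeval t g‖ < ‖aeval t (derivative g)‖ ^ 2) :
    Dense {r : ℚ_[p] | ∃ m n : ℤ, g.eval n ≠ 0 ∧
      r = ((g.eval m : ℤ) : ℚ_[p]) / ((g.eval n : ℤ) : ℚ_[p])} := by
  intro r
  set ε := ‖aeval t (derivative g)‖ ^ 2
  have hε : 0 < ε := (norm_nonneg _).trans_lt ht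
  obtain ⟨k, hk⟩ : ∃ k : ℕ, ‖(p : ℚ_[p]) ^ k‖ < min 1 ε ∧ ‖(p : ℚ_[p]) ^ k * r‖ < min 1 ε := by
    have hp : Filter.Tendsto (fun k : ℕ => (p : ℚ_[p]) ^ k) Filter.atTop (nhds 0) :=
      tendsto_pow_atTop_nhds_zero_of_norm_lt_one Padic.norm_p_lt_one
    have hε' : 0 < min 1 ε := lt_min one_pos hε
    have h₁ := hp.norm.eventually_lt_const (u := min 1 ε) (by simpa using hε')
    have h₂ := (hp.mul_const r).norm.eventually_lt_const (u := min 1 ε) (by simpa using hε')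
    exact (h₁.and h₂).exists
  obtain ⟨y, hy⟩ := exists_aeval_eq_of_norm_lt g t ht ⟨(p : ℚ_[p]) ^ k,
    (hk.1.trans_le (min_le_left _ _)).le⟩ (hk.1.trans_le (min_le_right _ _))
  obtain ⟨x, hx⟩ := exists_aeval_eq_of_norm_lt g t ht ⟨(p : ℚ_[p]) ^ k * r,
    (hk.2.trans_le (min_le_left _ _)).le⟩ (hk.2.trans_le (min_le_right _ _))
  have hpk : (p : ℚ_[p]) ^ k ≠ 0 := pow_ne_zero _ (by exact_mod_cast (Fact.out : p.Prime).ne_zero)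
  have hy0 : ((aeval y g : ℤ_[p]) : ℚ_[p]) ≠ 0 := by rw [hy]; exact hpk
  let Φ : ℤ_[p] × ℤ_[p] → ℚ_[p] := fun q =>
    ((aeval q.1 g : ℤ_[p]) : ℚ_[p]) / ((aeval q.2 g : ℤ_[p]) : ℚ_[p])
  have hcont : Continuous fun z : ℤ_[p] => ((aeval z g : ℤ_[p]) : ℚ_[p]) :=
    continuous_subtype_val.comp (g.continuous_aeval)
  have hΦ : ContinuousAt Φ (x, y) :=
    (hcont.comp continuous_fst).continuousAt.div (hcont.comp continuous_snd).continuousAt hy0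
  have hΦr : Φ (x, y) = r := by
    simp only [Φ, hx, hy]
    exact mul_div_cancel_left₀ r hpk
  rw [← hΦr, mem_closure_iff_nhds]
  intro U hU
  have hV : {q : ℤ_[p] × ℤ_[p] | ((aeval q.2 g : ℤ_[p]) : ℚ_[p]) ≠ 0} ∈ nhds (x, y) :=
    (hcont.comp continuous_snd).continuousAt.eventually_ne hy0
  obtain ⟨q, ⟨hqU, hqV⟩, ⟨m, n⟩, rfl⟩ :=
    mem_closure_iff_nhds.mp
      ((PadicInt.denseRange_intCast (p := p)).prodMap PadicInt.denseRange_intCast (x, y)) _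
      (Filter.inter_mem (hΦ hU) hV)
  have hcast (m : ℤ) : ((aeval (m : ℤ_[p]) g : ℤ_[p]) : ℚ_[p]) = ((g.eval m : ℤ) : ℚ_[p]) := by
    have := Polynomial.aeval_algebraMap_apply ℤ_[p] m g
    simp only [algebraMap_int_eq, eq_intCast, Polynomial.coe_aeval_eq_eval] at this
    rw [this, PadicInt.coe_intCast]
  refine ⟨_, hqU, m, n, ?_, ?_⟩
  · rintro h
    apply hqV
    simp [hcast, h]
  · simp [Φ, hcast]

/-- If a binary form restricted to an affine integral line has an approximate simple root in
`ℤ_[p]`, then its ratio set is dense in `ℚ_[p]`. -/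
theorem dense_ratioSet_of_norm_lt {p : ℕ} [Fact p.Prime] {k : ℕ} (F : MvPolynomial (Fin k) ℤ)
    (g : Polynomial ℤ) (v : ℤ → Fin k → ℤ) (hv : ∀ n, MvPolynomial.eval (v n) F = g.eval n)
    (t : ℤ_[p])
    (ht : ‖Polynomial.aeval t g‖ < ‖Polynomial.aeval t (Polynomial.derivative g)‖ ^ 2) :
    Dense (ratioSet p F) := by
  refine (dense_ratio_of_norm_lt g t ht).mono ?_
  rintro r ⟨m, n, hn, rfl⟩
  exact ⟨v m, v n, by rwa [hv], by rw [hv, hv]⟩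

/-- The discriminant of a cubic with three distinct roots, times `a ^ 2`, is the square of `a ^ 3`
times the product of the differences of the roots. -/
theorem cubic_discr_eq_sq_of_roots {K : Type*} [Field K] {a b c d x y z : K}
    (hx : a * x ^ 3 + b * x ^ 2 + c * x + d = 0) (hy : a * y ^ 3 + b * y ^ 2 + c * y + d = 0)
    (hz : a * z ^ 3 + b * z ^ 2 + c * z + d = 0) (hxy : x ≠ y) (hyz : y ≠ z) (hzx : z ≠ x) :
    a ^ 2 * b ^ 2 * c ^ 2 - 4 * a ^ 3 * c ^ 3 - 4 * a ^ 2 * b ^ 3 * d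
      - 27 * a ^ 4 * d ^ 2 + 18 * a ^ 3 * b * c * d =
    (a ^ 3 * ((x - y) * (y - z) * (z - x))) ^ 2 := by
  have h₁ : a * (x ^ 2 + x * y + y ^ 2) + b * (x + y) + c = 0 :=
    mul_left_cancel₀ (sub_ne_zero.mpr hxy) (by linear_combination hx - hy)
  have h₂ : a * (x ^ 2 + x * z + z ^ 2) + b * (x + z) + c = 0 :=
    mul_left_cancel₀ (sub_ne_zero.mpr hzx) (by linear_combination hz - hx)
  have hb : b = -a * (x + y + z) :=
    mul_left_cancel₀ (sub_ne_zero.mpr hyz) (by linear_combination h₁ - h₂)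
  obtain rfl : c = -(a * (x ^ 2 + x * y + y ^ 2) + b * (x + y)) := by linear_combination h₁
  obtain rfl : d = -(a * x ^ 3 + b * x ^ 2 +
    -(a * (x ^ 2 + x * y + y ^ 2) + b * (x + y)) * x) := by linear_combination hx
  subst hb
  ring

/-- If a cubic over `ZMod p` has no root there but has a root in the field with `p ^ 3` elements,
then its discriminant is a square. -/
theorem isSquare_discr_of_root {p : ℕ} [Fact p.Prime] {K : Type*} [Field K] [Fintype K]
    (hcard : Fintype.card K = p ^ 3) (i : ZMod p →+* K) {a b c d : ZMod p}
    (hroot : ∀ r, a * r ^ 3 + b * r ^ 2 + c * r + d ≠ 0) {x : K}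
    (hx : i a * x ^ 3 + i b * x ^ 2 + i c * x + i d = 0) :
    IsSquare (a ^ 2 * b ^ 2 * c ^ 2 - 4 * a ^ 3 * c ^ 3 - 4 * a ^ 2 * b ^ 3 * d
      - 27 * a ^ 4 * d ^ 2 + 18 * a ^ 3 * b * c * d) := by
  have : CharP K p := charP_of_injective_ringHom i.injective p
  have hfix {z : K} (hz : z ^ p = z) : ∃ e, i e = z := by
    have hz' : z ∈ (⊥ : Subfield K) := (Subfield.mem_bot_iff_pow_eq_self K p).mpr hz
    rw [← ZMod.fieldRange_castHom_eq_bot p] at hz'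
    obtain ⟨e, rfl⟩ := hz'
    exact ⟨e, RingHom.congr_fun (Subsingleton.elim _ _) e⟩
  have hi (e : ZMod p) : i e ^ p = i e := by rw [← map_pow, ZMod.pow_card]
  have frob {z : K} (hz : i a * z ^ 3 + i b * z ^ 2 + i c * z + i d = 0) :
      i a * (z ^ p) ^ 3 + i b * (z ^ p) ^ 2 + i c * z ^ p + i d = 0 := by
    have := congrArg (frobenius K p) hz
    simp only [map_add, map_mul, map_pow, map_zero] at this
    simpa only [frobenius_def, hi] using this
  have hxp : x ^ p ≠ x := by
    intro h
    obtain ⟨e, rfl⟩ := hfix h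
    exact hroot e (i.injective (by simpa using hx))
  have hx3 : ((x ^ p) ^ p) ^ p = x := by
    rw [← pow_mul, ← pow_mul, show p * (p * p) = p ^ 3 by ring, ← hcard]
    exact FiniteField.pow_card x
  have hinj : Function.Injective fun z : K => z ^ p := frobenius_inj K p
  have hyz : x ^ p ≠ (x ^ p) ^ p := fun h => hxp (hinj h).symm
  have hzx : (x ^ p) ^ p ≠ x := fun h => hyz (hinj (h.trans hx3.symm))
  have key := cubic_discr_eq_sq_of_roots hx (frob hx) (frob (frob hx)) hxp.symm hyz hzx
  obtain ⟨e, he⟩ := hfix (z := (x - x ^ p) * (x ^ p - (x ^ p) ^ p) * ((x ^ p) ^ p - x)) (by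
    rw [mul_pow, mul_pow, sub_pow_char, sub_pow_char, sub_pow_char, hx3]
    ring)
  refine ⟨a ^ 3 * e, i.injective ?_⟩
  rw [← he, sq (i a ^ 3 * i e)] at key
  simpa only [map_add, map_sub, map_mul, map_pow, map_ofNat] using key

open Polynomial in
/-- A cubic over `ZMod p` whose discriminant is not a square has a root. -/
theorem exists_root_of_not_isSquare_discr {p : ℕ} [Fact p.Prime] {a b c d : ZMod p}
    (hD : ¬ IsSquare (a ^ 2 * b ^ 2 * c ^ 2 - 4 * a ^ 3 * c ^ 3 - 4 * a ^ 2 * b ^ 3 * d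
      - 27 * a ^ 4 * d ^ 2 + 18 * a ^ 3 * b * c * d)) :
    ∃ r, a * r ^ 3 + b * r ^ 2 + c * r + d = 0 := by
  by_contra! hroot
  have ha : a ≠ 0 := by
    rintro rfl
    exact hD ⟨0, by ring⟩
  set f : (ZMod p)[X] := Polynomial.C a * Polynomial.X ^ 3 + Polynomial.C b * Polynomial.X ^ 2 +
    Polynomial.C c * Polynomial.X + Polynomial.C d with hf
  have hdeg : f.natDegree = 3 := natDegree_cubic ha
  have hirr : Irreducible f := by
    apply irreducible_of_degree_le_three_of_not_isRoot
    · simp [hdeg]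
    · intro r hr
      exact hroot r (by simpa [hf] using hr)
  have : Fact (Irreducible f) := ⟨hirr⟩
  have : Module.Finite (ZMod p) (AdjoinRoot f) := (AdjoinRoot.powerBasis hirr.ne_zero).finite
  have : Finite (AdjoinRoot f) := Module.finite_of_finite (ZMod p)
  let := Fintype.ofFinite (AdjoinRoot f)
  have hcard : Fintype.card (AdjoinRoot f) = p ^ 3 := by
    rw [Module.card_eq_pow_finrank (K := ZMod p), ZMod.card,
      (AdjoinRoot.powerBasis hirr.ne_zero).finrank, AdjoinRoot.powerBasis_dim, hdeg]
  refine hD (isSquare_discr_of_root hcard (AdjoinRoot.of f) hroot (x := AdjoinRoot.root f) ?_)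
  have := AdjoinRoot.eval₂_root f
  simpa [hf] using this

/-- Let `F(x,y) = ax³ + bx²y + cxy² + dy³` be a primitive integral binary cubic form and
`D = a²b²c² − 4a³c³ − 4a²b³d − 27a⁴d² + 18a³bcd`, and let `p` be a prime.
(1) If `a = 0` and `(b,c) ≠ (0,0)`, then `R(F)` is dense in `ℚ_p`.
(2) If `a ≠ 0`, `p > 3` and `D` is a quadratic non-residue mod `p`, then `R(F)` is dense
in `ℚ_p`. -/
theorem stmt10 (p : ℕ) [Fact p.Prime] (a b c d : ℤ)
    (F : MvPolynomial (Fin 2) ℤ)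
    (hFdef : F = C a * X 0 ^ 3 + C b * X 0 ^ 2 * X 1 + C c * X 0 * X 1 ^ 2 + C d * X 1 ^ 3)
    (hprim : Int.gcd (Int.gcd (Int.gcd a b) c) d = 1)
    (D : ℤ)
    (hD : D = a ^ 2 * b ^ 2 * c ^ 2 - 4 * a ^ 3 * c ^ 3 - 4 * a ^ 2 * b ^ 3 * d
      - 27 * a ^ 4 * d ^ 2 + 18 * a ^ 3 * b * c * d) :
    (a = 0 → (b, c) ≠ (0, 0) → Dense (ratioSet p F)) ∧
    (a ≠ 0 → 3 < p → legendreSym p D = -1 → Dense (ratioSet p F)) := by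
  subst hFdef
  constructor
  · rintro rfl hbc
    by_cases hb : b = 0
    · have hc : c ≠ 0 := by
        rintro rfl
        simp [hb] at hbc
      refine dense_ratioSet_of_norm_lt _
        (Polynomial.C (c ^ 3) * (Polynomial.X + Polynomial.C d)) (fun n => ![n, c]) ?_
        (-(d : ℤ_[p])) ?_
      · intro n
        simp [hb]
        ring
      · simp [hc]
    · refine dense_ratioSet_of_norm_lt _
        (Polynomial.C d * Polynomial.X ^ 3 + Polynomial.C c * Polynomial.X ^ 2 +
          Polynomial.C b * Polynomial.X) (fun n => ![1, n]) ?_ 0 ?_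
      · intro n
        simp
        ring
      · simp [hb]
  · intro _ _ hleg
    rw [legendreSym.eq_neg_one_iff, hD] at hleg
    push_cast at hleg
    obtain ⟨r, hr⟩ := exists_root_of_not_isSquare_discr hleg
    obtain ⟨t, rfl⟩ := ZMod.intCast_surjective r
    have hder : ((3 * a * t ^ 2 + 2 * b * t + c : ℤ) : ZMod p) ≠ 0 := by
      intro h
      push_cast at h
      refine hleg ⟨0, ?_⟩
      have hc : (c : ZMod p) = -(3 * a * t ^ 2 + 2 * b * t) := by linear_combination h
      have hd : (d : ZMod p) = -(a * t ^ 3 + b * t ^ 2 + c * t) := by linear_combination hr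
      rw [hd, hc]
      ring
    have hval : ((a * t ^ 3 + b * t ^ 2 + c * t + d : ℤ) : ZMod p) = 0 := by
      push_cast
      exact hr
    refine dense_ratioSet_of_norm_lt _
      (Polynomial.C a * Polynomial.X ^ 3 + Polynomial.C b * Polynomial.X ^ 2 +
        Polynomial.C c * Polynomial.X + Polynomial.C d) (fun n => ![n, 1]) ?_ (t : ℤ_[p]) ?_
    · intro n
      simp
    · have h₁ : ‖((a * t ^ 3 + b * t ^ 2 + c * t + d : ℤ) : ℤ_[p])‖ < 1 :=
        (PadicInt.norm_int_lt_one_iff_dvd _).mpr ((ZMod.intCast_zmod_eq_zero_iff_dvd _ p).mp hval)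
      have h₂ : ‖((3 * a * t ^ 2 + 2 * b * t + c : ℤ) : ℤ_[p])‖ = 1 :=
        le_antisymm (PadicInt.norm_le_one _) (not_lt.mp fun h => hder
          ((ZMod.intCast_zmod_eq_zero_iff_dvd _ p).mpr
            ((PadicInt.norm_int_lt_one_iff_dvd _).mp h)))
      convert h₁ using 1
      · simp
      · rw [← one_pow 2, ← h₂]
        congr 2
        simp [map_ofNat]
        ring
end

section
/- Let F(x,y) = ax^4 + bx^3y + cx^2y^2 + dxy^3 + ey^4 be an integral binary quartic form with a ≠ 0 and b ≠ 0, and let p > 3 be a prime dividing b. Then R(F) is dense in ℚ_p provided one of the following holds: (1) p ≡ 1 (mod 3), a^2c^2 + 12a^3e ≡ 0 (mod p), and 8a^3c^3 + 27a^4d^2 is a cubic non-residue modulo p; or (2) a^2c^2 + 12a^3e ≢ 0 (mod p) and s_{p+1} ≡ a^2c^2 − 4a^3e (mod p), where the sequence (s_n) is given by s_0 = 3, s_1 = −2ac, s_2 = 2a^2c^2 + 8a^3e, and s_{n+3} = −2ac·s_{n+2} + (4a^3e − a^2c^2)·s_{n+1} + a^4d^2·s_n for n ≥ 0. -/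
open MvPolynomial

theorem quartic_perm_cases {α : Type*} [AddCommMonoid α] {f : α → α} {a b c d : α}
    (h : [f a, f b, f c, f d].Perm [a, b, c, d]) :
    (f a = a ∨ f b = b ∨ f c = c ∨ f d = d) ∨
      (f a + f b = a + b ∨ f a + f b = c + d) ∨
      (f a + f c = a + c ∨ f a + f c = b + d) ∨
      (f a + f d = a + d ∨ f a + f d = b + c) := by
  rw [← List.mem_permutations] at h
  simp [List.permutations, List.permutationsAux, List.permutationsAux.rec,
    List.permutationsAux2] at h
  have := add_comm b a
  have := add_comm c a
  have := add_comm d a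
  have := add_comm c b
  have := add_comm d b
  have := add_comm d c
  rcases h with h | h | h | h | h | h | h | h | h | h | h | h | h | h | h | h | h | h | h | h | h |
    h | h | h <;> obtain ⟨h1, h2, h3, h4⟩ := h <;> simp_all

theorem ZMod.exists_algebraMap_eq_of_pow_eq {p : ℕ} [Fact p.Prime] {L : Type*} [Field L]
    [Algebra (ZMod p) L] {x : L} (hx : x ^ p = x) : ∃ y, algebraMap (ZMod p) L y = x := by
  have : CharP L p := charP_of_injective_algebraMap (algebraMap (ZMod p) L).injective p
  have h := (Subfield.mem_bot_iff_pow_eq_self (F := L) (p := p)).2 hx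
  have h2 : (⊥ : Subfield L) ≤ (algebraMap (ZMod p) L).fieldRange := bot_le
  exact h2 h

theorem ZMod.exists_root_quartic_of_forall_resolvent_ne_zero {p : ℕ} [Fact p.Prime]
    (P Q r : ZMod p)
    (h : ∀ u : ZMod p, u ^ 3 + 2 * P * u ^ 2 + (P ^ 2 - 4 * r) * u - Q ^ 2 ≠ 0) :
    ∃ z : ZMod p, z ^ 4 + P * z ^ 2 + Q * z + r = 0 := by
  obtain ⟨L, _, _, _⟩ : ∃ (L : Type) (_ : Field L) (_ : Algebra (ZMod p) L), IsAlgClosed L :=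
    ⟨AlgebraicClosure (ZMod p), inferInstance, inferInstance, inferInstance⟩
  obtain ⟨i, hi⟩ : ∃ i, i = algebraMap (ZMod p) L := ⟨_, rfl⟩
  have : CharP L p := charP_of_injective_algebraMap (algebraMap (ZMod p) L).injective p
  let g : Polynomial (ZMod p) := .X ^ 4 + .C P * .X ^ 2 + .C Q * .X + .C r
  have hdeg : g.natDegree = 4 := by simp only [g]; compute_degree!
  have hmon : g.Monic := by simp only [g]; monicity!
  have hs := IsAlgClosed.splits (g.map i)
  have hprod := hs.eq_prod_roots
  rw [(hmon.map i).leadingCoeff, Polynomial.C_1, one_mul] at hprod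
  have hcard := hs.natDegree_eq_card_roots
  rw [Polynomial.natDegree_map, hdeg] at hcard
  obtain ⟨l, hl⟩ := Quot.exists_rep (g.map i).roots
  change (l : Multiset L) = _ at hl
  rw [← hl] at hprod hcard
  match l, hcard with
  | [a, b, c, d], _ =>
  clear hl hs
  have hfrob : (frobenius L p).comp i = i := by
    exact RingHom.ext fun x => by simp [frobenius_def, ← map_pow]
  have hprod' := congrArg (Polynomial.map (frobenius L p)) hprod
  rw [Polynomial.map_map, hfrob] at hprod'
  have hperm : [frobenius L p a, frobenius L p b, frobenius L p c, frobenius L p d].Perm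
      [a, b, c, d] := by
    rw [← Multiset.coe_eq_coe]
    have h1 := congrArg Polynomial.roots hprod'
    have h2 := congrArg Polynomial.roots hprod
    rw [Polynomial.roots_multiset_prod_X_sub_C] at h2
    rw [← h2, h1]
    rw [← Polynomial.roots_multiset_prod_X_sub_C (Multiset.ofList [frobenius L p a, _, _, _])]
    simp
  have hcoe : ∀ n, (g.map i).coeff n = _ := fun n => congrArg (fun q => Polynomial.coeff q n) hprod
  have hexp : (Multiset.map (fun x => Polynomial.X - Polynomial.C x)
      (Multiset.ofList [a, b, c, d])).prod = Polynomial.X ^ 4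
        - Polynomial.C (a + b + c + d) * Polynomial.X ^ 3
        + Polynomial.C (a * b + a * c + a * d + b * c + b * d + c * d) * Polynomial.X ^ 2
        - Polynomial.C (a * b * c + a * b * d + a * c * d + b * c * d) * Polynomial.X
        + Polynomial.C (a * b * c * d) := by
    simp
    ring
  rw [hexp] at hcoe
  have e1 := hcoe 3
  have e2 := hcoe 2
  have e3 := hcoe 1
  have e4 := hcoe 0
  simp [g, Polynomial.coeff_X, Polynomial.coeff_C, -map_add, -map_mul] at e1 e2 e3 e4
  have hroot : ∀ x : L, frobenius L p x = x → x ∈ [a, b, c, d] →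
      ∃ z : ZMod p, z ^ 4 + P * z ^ 2 + Q * z + r = 0 := by
    intro x hx hmem
    obtain ⟨z, rfl⟩ := ZMod.exists_algebraMap_eq_of_pow_eq hx
    rw [← hi] at hmem
    refine ⟨z, i.injective ?_⟩
    have : (Polynomial.eval (i z)) (g.map i) = 0 := by
      rw [hprod, hexp]
      simp only [List.mem_cons, List.not_mem_nil, or_false] at hmem
      simp only [Polynomial.eval_add, Polynomial.eval_sub, Polynomial.eval_mul,
        Polynomial.eval_C, Polynomial.eval_pow, Polynomial.eval_X]
      rcases hmem with h | h | h | h <;> rw [← h] <;> ring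
    simpa [g] using this
  have hres : ∀ x : L, (frobenius L p x = x ∨ frobenius L p x = - x) →
      (x ^ 2) ^ 3 + 2 * i P * (x ^ 2) ^ 2 + (i P ^ 2 - 4 * i r) * x ^ 2 - i Q ^ 2 = 0 → False := by
    intro x hx hx0
    have : (x ^ 2) ^ p = x ^ 2 := by
      rw [← frobenius_def, map_pow]
      rcases hx with h | h <;> rw [h]; ring
    obtain ⟨u, hu⟩ := ZMod.exists_algebraMap_eq_of_pow_eq this
    refine h u (i.injective ?_)
    rw [← hu, ← hi] at hx0
    simpa only [map_add, map_sub, map_mul, map_pow, map_ofNat, map_zero] using hx0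
  have hd : d = -(a + b + c) := by linear_combination e1
  rcases quartic_perm_cases hperm with (h | h | h | h) | h | h | h
  · exact hroot _ h (by simp)
  · exact hroot _ h (by simp)
  · exact hroot _ h (by simp)
  · exact hroot _ h (by simp)
  · refine (hres (a + b) ?_ ?_).elim
    · rw [map_add]; exact h.imp id fun h => by rw [h, hd]; ring
    · rw [e2, e3, e4, hd]; ring
  · refine (hres (a + c) ?_ ?_).elim
    · rw [map_add]; exact h.imp id fun h => by rw [h, hd]; ring
    · rw [e2, e3, e4, hd]; ring
  · refine (hres (a + d) ?_ ?_).elim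
    · rw [map_add]; exact h.imp id fun h => by rw [h, hd]; ring
    · rw [e2, e3, e4, hd]; ring

theorem ZMod.exists_simple_root_quartic_of_forall_resolvent_ne_zero {p : ℕ} [Fact p.Prime]
    (P Q r : ZMod p)
    (h : ∀ u : ZMod p, u ^ 3 + 2 * P * u ^ 2 + (P ^ 2 - 4 * r) * u - Q ^ 2 ≠ 0) :
    ∃ z : ZMod p, z ^ 4 + P * z ^ 2 + Q * z + r = 0 ∧ 4 * z ^ 3 + 2 * P * z + Q ≠ 0 := by
  obtain ⟨z, hz⟩ := ZMod.exists_root_quartic_of_forall_resolvent_ne_zero P Q r h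
  refine ⟨z, hz, fun hz' => h (4 * z ^ 2) ?_⟩
  have hQ : Q = -4 * z ^ 3 - 2 * P * z := by linear_combination hz'
  have hr : r = 3 * z ^ 4 + P * z ^ 2 := by linear_combination hz - z * hz'
  rw [hQ, hr]
  ring

/-- If the power sums `sₙ` of the roots of a cubic over `ZMod p` satisfy `s_{p+1} = e₂` and
`e₁² ≠ 3 e₂`, then the cubic has no root in `ZMod p`. -/
theorem ZMod.cubic_ne_zero_of_powerSum {p : ℕ} [Fact p.Prime] (A B D : ZMod p) (s : ℕ → ZMod p)
    (hs0 : s 0 = 3) (hs1 : s 1 = A) (hs2 : s 2 = A ^ 2 - 2 * B)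
    (hrec : ∀ n, s (n + 3) = A * s (n + 2) - B * s (n + 1) + D * s n)
    (hAB : A ^ 2 ≠ 3 * B) (hsp : s (p + 1) = B) (u : ZMod p) :
    u ^ 3 - A * u ^ 2 + B * u - D ≠ 0 := by
  intro hu
  obtain ⟨L, _, _, _⟩ : ∃ (L : Type) (_ : Field L) (_ : Algebra (ZMod p) L), IsAlgClosed L :=
    ⟨AlgebraicClosure (ZMod p), inferInstance, inferInstance, inferInstance⟩
  obtain ⟨i, hi⟩ : ∃ i, i = algebraMap (ZMod p) L := ⟨_, rfl⟩
  have : CharP L p := charP_of_injective_algebraMap (algebraMap (ZMod p) L).injective p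
  have hfrob : ∀ x, frobenius L p (i x) = i x := fun x => by simp [frobenius_def, ← map_pow]
  obtain ⟨v, hv⟩ := IsAlgClosed.exists_root
    (.X ^ 2 + .C (i (u - A)) * .X + .C (i (u ^ 2 - A * u + B)) : Polynomial L) (by
      rw [show Polynomial.degree _ = 2 by compute_degree!]; decide)
  replace hv : v ^ 2 + (i u - i A) * v + (i u ^ 2 - i A * i u + i B) = 0 := by
    simpa [Polynomial.IsRoot] using hv
  obtain ⟨w, hw⟩ : ∃ w, w = i A - i u - v := ⟨_, rfl⟩
  have hD : i D = i u ^ 3 - i A * i u ^ 2 + i B * i u := by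
    simp only [← map_pow, ← map_mul, ← map_sub, ← map_add]
    congr 1
    linear_combination -hu
  have hA : i A = i u + v + w := by rw [hw]; ring
  have hB : i B = i u * v + i u * w + v * w := by rw [hw]; linear_combination hv
  have hsum : ∀ n, i (s n) = i u ^ n + v ^ n + w ^ n ∧
      i (s (n + 1)) = i u ^ (n + 1) + v ^ (n + 1) + w ^ (n + 1) ∧
      i (s (n + 2)) = i u ^ (n + 2) + v ^ (n + 2) + w ^ (n + 2) := by
    intro n
    induction n with
    | zero =>
      simp only [zero_add, hs0, hs1, hs2, map_sub, map_mul, map_pow, map_ofNat, hA, hB]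
      refine ⟨?_, ?_, ?_⟩ <;> ring
    | succ n ih =>
      refine ⟨ih.2.1, ih.2.2, ?_⟩
      have h3 := hrec n
      rw [show n + 1 + 2 = n + 3 by rfl, h3, map_add, map_sub, map_mul, map_mul, map_mul, ih.1,
        ih.2.1, ih.2.2, hD, hB, hA]
      ring
  have hp := (hsum p).2.1
  rw [hsp] at hp
  have hne : i A ^ 2 ≠ 3 * i B := fun h => hAB (i.injective (by
    simpa only [map_pow, map_mul, map_ofNat] using h))
  have hv' := congrArg (frobenius L p) hv
  simp only [map_add, map_sub, map_mul, map_pow, hfrob, map_zero] at hv'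
  have hw' : frobenius L p w = i A - i u - frobenius L p v := by
    rw [hw]; simp only [map_sub, hfrob]
  have hprod : (frobenius L p v - v) * (frobenius L p v - w) = 0 := by
    rw [hw]; linear_combination hv' - hv
  simp only [pow_succ, ← frobenius_def, hfrob] at hp
  rcases mul_eq_zero.1 hprod with h | h
  · have h1 : frobenius L p v = v := sub_eq_zero.1 h
    rw [hw', h1] at hp
    apply hne
    linear_combination (i A + i u + v + w) * hA - 2 * hB - hp - w * hA
  · have h1 : frobenius L p v = w := sub_eq_zero.1 h
    rw [hw', h1] at hp
    have h2 : (i u - v) * (i u - w) = 0 := by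
      linear_combination -hp + hB - w * hA
    have h3 : v = w := by
      rcases mul_eq_zero.1 h2 with h | h
      · rw [← h1, ← sub_eq_zero.1 h, hfrob]
      · have h4 := congrArg (frobenius L p) (sub_eq_zero.1 h)
        rw [hfrob, hw', h1] at h4
        linear_combination h - h4 - hA
    apply hne
    rw [hA, hB, ← h3]
    rw [← h3] at h2
    linear_combination h2

theorem PadicInt.exists_eval_eq_of_simple_root {p : ℕ} [Fact p.Prime] (f : Polynomial ℤ) (x : ℤ)
    (hx : (p : ℤ) ∣ f.eval x) (hx' : ¬ (p : ℤ) ∣ f.derivative.eval x)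
    {t : ℤ_[p]} (ht : ‖t‖ < 1) : ∃ z : ℤ_[p], Polynomial.aeval z f = t := by
  have hint : ∀ g : Polynomial ℤ, Polynomial.eval (x : ℤ_[p]) (g.map (Int.castRingHom _)) =
      (g.eval x : ℤ) := fun g => by simp
  have hd : ‖((f.derivative.eval x : ℤ) : ℤ_[p])‖ = 1 := by
    refine le_antisymm (PadicInt.norm_le_one _) (not_lt.1 fun h => hx' ?_)
    exact (PadicInt.norm_int_lt_one_iff_dvd _).1 h
  obtain ⟨z, hz, -⟩ := hensels_lemma (p := p) (a := (x : ℤ_[p]))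
      (F := f.map (Int.castRingHom ℤ_[p]) - .C t) (by
    simp only [Polynomial.coe_aeval_eq_eval, Polynomial.derivative_sub, Polynomial.derivative_map,
      Polynomial.derivative_C, sub_zero, Polynomial.eval_sub, Polynomial.eval_C, hint, hd, one_pow]
    rw [sub_eq_add_neg]
    refine (PadicInt.nonarchimedean _ _).trans_lt (max_lt ?_ (by rwa [norm_neg]))
    exact (PadicInt.norm_int_lt_one_iff_dvd _).2 hx)
  refine ⟨z, ?_⟩
  simpa [sub_eq_zero, Polynomial.aeval_def, Polynomial.eval_map] using hz

theorem dense_ratioSet_of_simple_root {p : ℕ} [Fact p.Prime] (F : MvPolynomial (Fin 2) ℤ)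
    (f : Polynomial ℤ) (hf : ∀ x : ℤ, eval ![x, 1] F = f.eval x) (x : ℤ)
    (hx : (p : ℤ) ∣ f.eval x) (hx' : ¬ (p : ℤ) ∣ f.derivative.eval x) :
    Dense (ratioSet p F) := by
  have hp0 : (p : ℚ_[p]) ≠ 0 := by exact_mod_cast (Fact.out : p.Prime).ne_zero
  have hp1 : ‖(p : ℤ_[p])‖ < 1 := by simpa using Padic.norm_p_lt_one (p := p)
  intro t
  obtain ⟨k, t', ht'⟩ : ∃ (k : ℕ) (t' : ℤ_[p]), (t' : ℚ_[p]) = t * (p : ℚ_[p]) ^ k := by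
    have h := tendsto_pow_atTop_nhds_zero_of_norm_lt_one (x := (p : ℚ_[p]))
      (by simpa using Padic.norm_p_lt_one (p := p))
    have h2 := (h.const_mul t).norm
    rw [mul_zero, norm_zero] at h2
    obtain ⟨k, hk⟩ := (h2.eventually (gt_mem_nhds one_pos)).exists
    exact ⟨k, ⟨_, hk.le⟩, rfl⟩
  obtain ⟨z₁, hz₁⟩ := PadicInt.exists_eval_eq_of_simple_root f x hx hx' (t := t' * p) (by
    rw [norm_mul]
    exact (mul_le_of_le_one_left (norm_nonneg _) (PadicInt.norm_le_one _)).trans_lt hp1)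
  obtain ⟨z₂, hz₂⟩ := PadicInt.exists_eval_eq_of_simple_root f x hx hx' (t := (p : ℤ_[p]) ^ (k + 1))
    (by rw [norm_pow]; exact pow_lt_one₀ (norm_nonneg _) hp1 (by omega))
  let φ : ℤ_[p] → ℚ_[p] := fun z => (Polynomial.aeval z f : ℤ_[p])
  have hφ : Continuous φ := continuous_subtype_val.comp (Polynomial.continuous_aeval f)
  have h1 : φ z₁ = t * (p : ℚ_[p]) ^ (k + 1) := by
    simp only [φ, hz₁]; push_cast; rw [ht']; ring
  have h2 : φ z₂ = (p : ℚ_[p]) ^ (k + 1) := by simp only [φ, hz₂]; push_cast; rfl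
  have h20 : φ z₂ ≠ 0 := h2 ▸ pow_ne_zero _ hp0
  have hcont : ContinuousAt (fun z : ℤ_[p] × ℤ_[p] => φ z.1 / φ z.2) (z₁, z₂) :=
    (hφ.comp continuous_fst).continuousAt.div (hφ.comp continuous_snd).continuousAt h20
  have hval : φ z₁ / φ z₂ = t := by rw [h1, h2, mul_div_cancel_right₀ _ (pow_ne_zero _ hp0)]
  have hint : ∀ m : ℤ, φ m = (eval ![m, 1] F : ℤ) := fun m => by
    rw [hf]
    simp only [φ]
    rw [show Polynomial.aeval (m : ℤ_[p]) f = (f.eval m : ℤ) by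
      simpa using Polynomial.aeval_algebraMap_apply ℤ_[p] m f]
    push_cast; rfl
  rw [mem_closure_iff_nhds]
  intro U hU
  have hU' := hcont.preimage_mem_nhds (show U ∈ nhds (φ z₁ / φ z₂) by rwa [hval])
  have hne : {z : ℤ_[p] × ℤ_[p] | φ z.2 ≠ 0} ∈ nhds (z₁, z₂) :=
    (hφ.comp continuous_snd).continuousAt.eventually_ne h20
  obtain ⟨w, hw, ⟨m, n⟩, rfl⟩ := mem_closure_iff_nhds.1
    ((PadicInt.denseRange_intCast.prodMap PadicInt.denseRange_intCast) (z₁, z₂)) _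
    (Filter.inter_mem hU' hne)
  refine ⟨_, hw.1, ![m, 1], ![n, 1], fun h => hw.2 ?_, ?_⟩
  · simp [hint, h]
  · simp [hint]

/-- Let `F(x,y) = ax⁴ + bx³y + cx²y² + dxy³ + ey⁴` be an integral binary quartic form with
`a, b ≠ 0`, and let `p > 3` be a prime dividing `b`. If either
(1) `p ≡ 1 (mod 3)`, `a²c² + 12a³e ≡ 0 (mod p)` and `8a³c³ + 27a⁴d²` is a cubic non-residue
mod `p`, or
(2) `a²c² + 12a³e ≢ 0 (mod p)` and `s_{p+1} ≡ a²c² − 4a³e (mod p)` for the recursively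
defined sequence `s`, then `R(F)` is dense in `ℚ_p`. -/
theorem stmt11 (p : ℕ) [Fact p.Prime] (hp3 : 3 < p) (a b c d e : ℤ)
    (ha : a ≠ 0) (hb : b ≠ 0) (hpb : (p : ℤ) ∣ b)
    (F : MvPolynomial (Fin 2) ℤ)
    (hFdef : F = C a * X 0 ^ 4 + C b * X 0 ^ 3 * X 1 + C c * X 0 ^ 2 * X 1 ^ 2
      + C d * X 0 * X 1 ^ 3 + C e * X 1 ^ 4)
    (s : ℕ → ℤ)
    (hs0 : s 0 = 3) (hs1 : s 1 = -2 * a * c) (hs2 : s 2 = 2 * a ^ 2 * c ^ 2 + 8 * a ^ 3 * e)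
    (hsrec : ∀ n : ℕ, s (n + 3) = -2 * a * c * s (n + 2)
      + (4 * a ^ 3 * e - a ^ 2 * c ^ 2) * s (n + 1) + a ^ 4 * d ^ 2 * s n)
    (hcond :
      (p % 3 = 1 ∧ ((a ^ 2 * c ^ 2 + 12 * a ^ 3 * e : ℤ) : ZMod p) = 0 ∧
        ¬ ∃ y : ZMod p, y ^ 3 = ((8 * a ^ 3 * c ^ 3 + 27 * a ^ 4 * d ^ 2 : ℤ) : ZMod p)) ∨
      (((a ^ 2 * c ^ 2 + 12 * a ^ 3 * e : ℤ) : ZMod p) ≠ 0 ∧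
        ((s (p + 1) : ℤ) : ZMod p) = ((a ^ 2 * c ^ 2 - 4 * a ^ 3 * e : ℤ) : ZMod p))) :
    Dense (ratioSet p F) := by
  have hbp : (b : ZMod p) = 0 := (ZMod.intCast_zmod_eq_zero_iff_dvd _ _).2 hpb
  have hap : (a : ZMod p) ≠ 0 := by
    intro h
    rcases hcond with ⟨-, -, h2⟩ | ⟨h1, -⟩
    · exact h2 ⟨0, by push_cast; rw [h]; ring⟩
    · exact h1 (by push_cast; rw [h]; ring)
  have hres : ∀ u : ZMod p, u ^ 3 + 2 * (a * c) * u ^ 2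
      + ((a * c) ^ 2 - 4 * (a ^ 3 * e)) * u - (a ^ 2 * d) ^ 2 ≠ 0 := by
    intro u hu
    rcases hcond with ⟨-, h1, h2⟩ | ⟨h1, h2⟩
    · refine h2 ⟨3 * u + 2 * a * c, ?_⟩
      push_cast at h1 ⊢
      linear_combination 27 * hu + 9 * u * h1
    · refine ZMod.cubic_ne_zero_of_powerSum (-2 * a * c : ZMod p)
        (a ^ 2 * c ^ 2 - 4 * a ^ 3 * e) (a ^ 4 * d ^ 2) (fun n => (s n : ZMod p))
        (by simp [hs0]) (by simp [hs1]) ?_ ?_ ?_ ?_ u ?_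
      · simp only [hs2]; push_cast; ring
      · intro n; simp only [hsrec]; push_cast; ring
      · intro h
        apply h1
        push_cast
        linear_combination h
      · simp only [h2]; push_cast; ring
      · linear_combination hu
  obtain ⟨z, hz, hz'⟩ := ZMod.exists_simple_root_quartic_of_forall_resolvent_ne_zero _ _ _ hres
  obtain ⟨x, hx⟩ := ZMod.intCast_surjective (z / (a : ZMod p))
  have hzx : z = a * x := by rw [hx]; field_simp
  rw [hzx] at hz hz'
  refine dense_ratioSet_of_simple_root F (.C a * .X ^ 4 + .C b * .X ^ 3 + .C c * .X ^ 2
    + .C d * .X + .C e) (fun x => by simp [hFdef]) x ?_ ?_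
  · rw [← ZMod.intCast_zmod_eq_zero_iff_dvd]
    simp [hbp]
    refine (mul_eq_zero.1 ?_).resolve_left (pow_ne_zero 3 hap)
    linear_combination hz
  · rw [← ZMod.intCast_zmod_eq_zero_iff_dvd]
    simp [hbp]
    intro h
    apply hz'
    linear_combination a ^ 2 * h
end

section
/- Let p be a prime and let F ∈ ℤ[x_0,…,x_{m−1}] be an integral form. Suppose there exist c_1,…,c_{m−1} ∈ ℤ_p, z_1 ∈ ℤ_p, a positive integer a, and f_1 ∈ ℤ_p[x] with F(x,c_1,…,c_{m−1}) = (x − z_1)^a f_1(x), and there exist d_0,d_2,…,d_{m−1} ∈ ℤ_p, z_2 ∈ ℤ_p, a positive integer b, and f_2 ∈ ℤ_p[y] with F(d_0,y,d_2,…,d_{m−1}) = (y − z_2)^b f_2(y), such that f_1(z_1)·f_2(z_2) ≠ 0 and gcd(a,b) = 1. Then R(F) is dense in ℚ_p. -/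
open MvPolynomial

open Filter Topology

/-- Ratios of values of `F` at `p`-adic integer points lie in the closure of the ratio set. -/
theorem aeval_div_aeval_mem_closure_ratioSet (p : ℕ) [Fact p.Prime] {n : ℕ}
    (F : MvPolynomial (Fin n) ℤ) (x y : Fin n → ℤ_[p]) (hy : aeval y F ≠ 0) :
    ((aeval x F : ℤ_[p]) : ℚ_[p]) / ((aeval y F : ℤ_[p]) : ℚ_[p]) ∈ closure (ratioSet p F) := by
  have hc : Continuous fun z : Fin n → ℤ_[p] => ((aeval z F : ℤ_[p]) : ℚ_[p]) := by
    have h : Continuous fun z : Fin n → ℤ_[p] => aeval z F := by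
      simp only [aeval_def, eval₂_eq_eval_map]
      exact MvPolynomial.continuous_eval _
    exact continuous_subtype_val.comp h
  have hy' : ((aeval y F : ℤ_[p]) : ℚ_[p]) ≠ 0 := by simpa using hy
  have hdense : DenseRange (Prod.map (Pi.map fun _ => Int.cast) (Pi.map fun _ => Int.cast) :
      (Fin n → ℤ) × (Fin n → ℤ) → (Fin n → ℤ_[p]) × (Fin n → ℤ_[p])) := by
    have h : DenseRange (Pi.map fun _ => Int.cast : (Fin n → ℤ) → Fin n → ℤ_[p]) :=
      DenseRange.piMap fun _ => PadicInt.denseRange_intCast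
    exact h.prodMap h
  have hcast (z : Fin n → ℤ) :
      ((aeval (Pi.map (fun _ => Int.cast) z : Fin n → ℤ_[p]) F : ℤ_[p]) : ℚ_[p]) =
        ((MvPolynomial.eval z F : ℤ) : ℚ_[p]) := by
    have := MvPolynomial.aeval_algebraMap_apply ℤ_[p] z F
    rw [show (Pi.map (fun _ => Int.cast) z : Fin n → ℤ_[p]) = algebraMap ℤ ℤ_[p] ∘ z from rfl,
      this]
    simp
  have hcont : ContinuousAt (fun z : (Fin n → ℤ_[p]) × (Fin n → ℤ_[p]) =>
      ((aeval z.1 F : ℤ_[p]) : ℚ_[p]) / ((aeval z.2 F : ℤ_[p]) : ℚ_[p])) (x, y) :=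
    (hc.comp continuous_fst).continuousAt.div (hc.comp continuous_snd).continuousAt hy'
  have hne : ∀ᶠ z : (Fin n → ℤ_[p]) × (Fin n → ℤ_[p]) in 𝓝 (x, y),
      ((aeval z.2 F : ℤ_[p]) : ℚ_[p]) ≠ 0 :=
    (hc.comp continuous_snd).continuousAt.eventually_ne hy'
  refine mem_closure_iff_nhds.2 fun U hU => ?_
  obtain ⟨z, hzU, hz⟩ := hdense.exists_mem_open isOpen_interior
    ⟨(x, y), mem_interior_iff_mem_nhds.2 (inter_mem (hcont hU) hne)⟩ |>.imp
      fun _ h => interior_subset h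
  simp only [Set.mem_preimage, Prod.map_fst, Prod.map_snd, hcast] at hzU
  simp only [Set.mem_ofPred_eq, Prod.map_snd, hcast] at hz
  exact ⟨_, hzU, z.1, z.2, by exact_mod_cast hz, rfl⟩

theorem Nat.Coprime.exists_mul_eq_mul_add_one {a b : ℕ} (ha : 0 < a) (hb : 0 < b)
    (h : Nat.Coprime a b) : ∃ i j : ℕ, a * i = b * j + 1 := by
  obtain rfl | hb : b = 1 ∨ 1 < b := by lia
  · exact ⟨1, a - 1, by lia⟩
  · obtain ⟨i, -, hi⟩ := Nat.exists_mul_mod_eq_one_of_coprime h hb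
    exact ⟨i, a * i / b, by rw [← hi, Nat.div_add_mod]⟩

theorem PadicInt.tendsto_mul_prime_pow_pow (p : ℕ) [Fact p.Prime] (t : ℤ_[p]) {k : ℕ}
    (hk : 0 < k) : Tendsto (fun N : ℕ => t * ((p : ℤ_[p]) ^ N) ^ k) atTop (𝓝 0) := by
  have h : Tendsto (fun N : ℕ => (p : ℤ_[p]) ^ N) atTop (𝓝 0) :=
    tendsto_pow_atTop_nhds_zero_of_norm_lt_one (by simpa using PadicInt.norm_lt_one_iff_dvd (p : ℤ_[p]))
  simpa [hk.ne'] using (h.pow k).const_mul t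

/-- If `a` and `b` are coprime, every quotient of nonzero `p`-adic integers has the form
`u ^ a / v ^ b` with `u` and `v` arbitrarily small. -/
theorem PadicInt.exists_tendsto_pow_mul_eq_pow_mul (p : ℕ) [Fact p.Prime] {a b : ℕ}
    (ha : 0 < a) (hb : 0 < b) (hab : Nat.Coprime a b) {s t : ℤ_[p]} (hs : s ≠ 0) (ht : t ≠ 0) :
    ∃ u v : ℕ → ℤ_[p], Tendsto u atTop (𝓝 0) ∧ Tendsto v atTop (𝓝 0) ∧ (∀ N, v N ≠ 0) ∧
      ∀ N, u N ^ a * t = v N ^ b * s := by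
  obtain ⟨i, j, hij⟩ := hab.exists_mul_eq_mul_add_one ha hb
  obtain ⟨l, k, hlk⟩ := hab.symm.exists_mul_eq_mul_add_one hb ha
  refine ⟨fun N => s ^ i * t ^ k * ((p : ℤ_[p]) ^ N) ^ b,
    fun N => s ^ j * t ^ l * ((p : ℤ_[p]) ^ N) ^ a,
    tendsto_mul_prime_pow_pow p _ hb, tendsto_mul_prime_pow_pow p _ ha, fun N => ?_, fun N => ?_⟩
  · have hp : (p : ℤ_[p]) ≠ 0 := by exact_mod_cast (Fact.out : p.Prime).ne_zero
    positivity
  · have h₁ : s ^ (a * i) = s ^ (b * j) * s := by rw [hij, pow_succ]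
    have h₂ : t ^ (b * l) = t ^ (a * k) * t := by rw [hlk, pow_succ]
    simp only [mul_pow, ← pow_mul, mul_comm i a, mul_comm j b, mul_comm k a, mul_comm l b, h₁, h₂]
    ring

/-- Evaluating a specialization of `F` gives a value of `F`. -/
theorem eval_aeval_ite {R : Type*} [CommRing R] {σ : Type*} (q : σ → Prop) [DecidablePred q]
    (F : MvPolynomial σ ℤ) (c : σ → R) (g : Polynomial R)
    (h : aeval (fun i => if q i then Polynomial.X else Polynomial.C (c i)) F = g) (t : R) :
    aeval (fun i => if q i then t else c i) F = g.eval t := by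
  rw [← h, ← Polynomial.coe_evalRingHom, MvPolynomial.map_aeval, aeval_def, coe_eval₂Hom]
  congr 1
  · exact RingHom.ext_int _ _
  · ext i
    split_ifs <;> simp

/-- If an integral form `F` specializes, over `ℤ_p`, in its first variable to
`(x - z₁)^a f₁(x)` and in its second variable to `(y - z₂)^b f₂(y)` with
`f₁(z₁)·f₂(z₂) ≠ 0` and `gcd(a,b) = 1`, then `R(F)` is dense in `ℚ_p`. -/
theorem stmt13 (p : ℕ) [Fact p.Prime] (m : ℕ) (hm : 2 ≤ m)
    (F : MvPolynomial (Fin m) ℤ) (dd : ℕ) (hF : F.IsHomogeneous dd)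
    (c : Fin m → ℤ_[p]) (z1 : ℤ_[p]) (a : ℕ) (ha : 0 < a) (f1 : Polynomial ℤ_[p])
    (h1 : MvPolynomial.aeval
        (fun i : Fin m => if (i : ℕ) = 0 then Polynomial.X else Polynomial.C (c i)) F =
      (Polynomial.X - Polynomial.C z1) ^ a * f1)
    (dcoef : Fin m → ℤ_[p]) (z2 : ℤ_[p]) (b : ℕ) (hb : 0 < b) (f2 : Polynomial ℤ_[p])
    (h2 : MvPolynomial.aeval
        (fun i : Fin m => if (i : ℕ) = 1 then Polynomial.X else Polynomial.C (dcoef i)) F =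
      (Polynomial.X - Polynomial.C z2) ^ b * f2)
    (hne : f1.eval z1 * f2.eval z2 ≠ 0)
    (hab : Nat.Coprime a b) :
    Dense (ratioSet p F) := by
  have hf1 : f1.eval z1 ≠ 0 := left_ne_zero_of_mul hne
  have hf2 : f2.eval z2 ≠ 0 := right_ne_zero_of_mul hne
  rw [← dense_closure]
  refine (dense_compl_singleton (0 : ℚ_[p])).mono fun r hr => ?_
  obtain ⟨r1, r2, hr2, rfl⟩ := IsFractionRing.div_surjective (A := ℤ_[p]) r
  have hr2 : r2 ≠ 0 := nonZeroDivisors.ne_zero hr2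
  have hr1 : r1 ≠ 0 := by rintro rfl; simp at hr
  obtain ⟨u, v, hu, hv, hv0, huv⟩ := PadicInt.exists_tendsto_pow_mul_eq_pow_mul p ha hb hab
    (mul_ne_zero hr1 hf2) (mul_ne_zero hr2 hf1)
  have hlim (f : Polynomial ℤ_[p]) (z : ℤ_[p]) {w : ℕ → ℤ_[p]} (hw : Tendsto w atTop (𝓝 0)) :
      Tendsto (fun N => f.eval (z + w N)) atTop (𝓝 (f.eval z)) := by
    exact (f.continuous.tendsto z).comp (by simpa using hw.const_add z)
  have hcoe (t : ℤ_[p]) : Tendsto ((↑) : ℤ_[p] → ℚ_[p]) (𝓝 t) (𝓝 (t : ℚ_[p])) :=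
    continuous_subtype_val.tendsto t
  have hf1' : ((f1.eval z1 : ℤ_[p]) : ℚ_[p]) ≠ 0 := by simpa using hf1
  have hf2' : ((f2.eval z2 : ℤ_[p]) : ℚ_[p]) ≠ 0 := by simpa using hf2
  have hr2' : (r2 : ℚ_[p]) ≠ 0 := by simpa using hr2
  have htend := ((((hcoe _).comp (hlim f1 z1 hu)).div ((hcoe _).comp (hlim f2 z2 hv))
    hf2').const_mul ((r1 * f2.eval z2 : ℚ_[p]) / (r2 * f1.eval z1)))
  have hval : (r1 * f2.eval z2 : ℚ_[p]) / (r2 * f1.eval z1) * (f1.eval z1 / f2.eval z2) =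
      algebraMap ℤ_[p] ℚ_[p] r1 / algebraMap ℤ_[p] ℚ_[p] r2 := by
    simp only [PadicInt.algebraMap_apply]
    field_simp
  rw [hval] at htend
  refine isClosed_closure.mem_of_tendsto htend ?_
  filter_upwards [(hlim f2 z2 hv).eventually_ne hf2] with N hN
  have e1 := eval_aeval_ite (fun i : Fin m => (i : ℕ) = 0) F c _ h1 (z1 + u N)
  have e2 := eval_aeval_ite (fun i : Fin m => (i : ℕ) = 1) F dcoef _ h2 (z2 + v N)
  simp only [Polynomial.eval_mul, Polynomial.eval_pow, Polynomial.eval_sub, Polynomial.eval_X,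
    Polynomial.eval_C, add_sub_cancel_left] at e1 e2
  have hmem := aeval_div_aeval_mem_closure_ratioSet p F
    (fun i => if (i : ℕ) = 0 then z1 + u N else c i)
    (fun i => if (i : ℕ) = 1 then z2 + v N else dcoef i)
    (by rw [e2]; exact mul_ne_zero (pow_ne_zero _ (hv0 N)) hN)
  rw [e1, e2] at hmem
  convert hmem using 1
  have hv0' : (v N : ℚ_[p]) ≠ 0 := by simpa using hv0 N
  have hN' : ((f2.eval (z2 + v N) : ℤ_[p]) : ℚ_[p]) ≠ 0 := by simpa using hN
  have h : (u N : ℚ_[p]) ^ a * (r2 * f1.eval z1) = (v N : ℚ_[p]) ^ b * (r1 * f2.eval z2) := by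
    exact_mod_cast congrArg ((↑) : ℤ_[p] → ℚ_[p]) (huv N)
  have hquot : (r1 * f2.eval z2 : ℚ_[p]) / (r2 * f1.eval z1) = (u N : ℚ_[p]) ^ a / v N ^ b := by
    rw [div_eq_div_iff (mul_ne_zero hr2' hf1') (pow_ne_zero _ hv0'), h, mul_comm]
  simp only [hquot, PadicInt.coe_mul, PadicInt.coe_pow]
  exact div_mul_div_comm _ _ _ _
end

section
/- Let p be a prime and let f : ℤ_p^r → ℤ_p be a continuous function. Suppose that for every z ∈ ℤ_p there exist x, y ∈ ℤ_p^r with f(y) ≠ 0 and f(x)/f(y) = z. Then the ratio set {f(x)/f(y) : x, y ∈ ℤ^r (tuples of integers), f(y) ≠ 0} is dense in ℚ_p. -/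
/-- If every `p`-adic integer is a ratio of values of `f`, then so is every `p`-adic number. -/
theorem exists_div_eq_of_forall_padicInt {p : ℕ} [Fact p.Prime] {X : Type*} (f : X → ℤ_[p])
    (hall : ∀ z : ℤ_[p], ∃ x y, f y ≠ 0 ∧ (f x : ℚ_[p]) / (f y : ℚ_[p]) = (z : ℚ_[p]))
    (q : ℚ_[p]) : ∃ x y, f y ≠ 0 ∧ (f x : ℚ_[p]) / (f y : ℚ_[p]) = q := by
  rcases le_total ‖q‖ 1 with hq | hq
  · exact hall ⟨q, hq⟩
  · have hq0 : q ≠ 0 := norm_pos_iff.mp (by linarith)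
    have hinv : ‖q⁻¹‖ ≤ 1 := by
      rw [norm_inv]
      exact inv_le_one_of_one_le₀ hq
    obtain ⟨x, y, -, h⟩ := hall ⟨q⁻¹, hinv⟩
    refine ⟨y, x, ?_, by rw [← inv_div, h, inv_inv]⟩
    intro hx
    rw [hx, PadicInt.coe_zero, zero_div] at h
    exact inv_ne_zero hq0 h.symm

/-- Integer tuples are dense in `ℤ_[p]`-tuples. -/
theorem denseRange_intCast_pi (p : ℕ) [Fact p.Prime] (ι : Type*) :
    DenseRange (fun (x : ι → ℤ) (i : ι) => (x i : ℤ_[p])) :=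
  DenseRange.piMap fun _ => PadicInt.denseRange_intCast

/-- Let `f : ℤ_p^r → ℤ_p` be continuous. If every `z ∈ ℤ_p` can be written as a quotient
`f(x)/f(y)` with `x, y ∈ ℤ_p^r` and `f(y) ≠ 0`, then the ratio set of `f` over the integer
tuples `ℤ^r` is dense in `ℚ_p`. -/
theorem stmt15 (p : ℕ) [Fact p.Prime] (r : ℕ) (f : (Fin r → ℤ_[p]) → ℤ_[p])
    (hf : Continuous f)
    (hall : ∀ z : ℤ_[p], ∃ x y : Fin r → ℤ_[p], f y ≠ 0 ∧
      ((f x : ℚ_[p]) / (f y : ℚ_[p]) = (z : ℚ_[p]))) :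
    Dense { t : ℚ_[p] | ∃ x y : Fin r → ℤ,
      f (fun i => (y i : ℤ_[p])) ≠ 0 ∧
      t = (f (fun i => (x i : ℤ_[p])) : ℚ_[p]) / (f (fun i => (y i : ℤ_[p])) : ℚ_[p]) } := by
  rw [dense_iff_inter_open]
  rintro U hU ⟨q, hq⟩
  obtain ⟨x, y, hy, rfl⟩ := exists_div_eq_of_forall_padicInt f hall q
  have hcoe : Continuous fun z => (f z : ℚ_[p]) := continuous_subtype_val.comp hf
  have hdiv : ContinuousAt (fun z : (Fin r → ℤ_[p]) × (Fin r → ℤ_[p]) =>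
      (f z.1 : ℚ_[p]) / (f z.2 : ℚ_[p])) (x, y) :=
    (hcoe.comp continuous_fst).continuousAt.div (hcoe.comp continuous_snd).continuousAt
      (by simpa using hy)
  have hne : ∀ᶠ z : (Fin r → ℤ_[p]) × (Fin r → ℤ_[p]) in nhds (x, y), f z.2 ≠ 0 :=
    (hf.comp continuous_snd).continuousAt.eventually_ne hy
  have hd := denseRange_intCast_pi p (Fin r)
  obtain ⟨⟨a, b⟩, hab, hb⟩ := (hd.prodMap hd).exists_mem_open isOpen_interior
    ⟨(x, y), mem_interior_iff_mem_nhds.mpr ((hdiv.eventually (hU.mem_nhds hq)).and hne)⟩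
    |>.imp fun _ h => interior_subset h
  exact ⟨_, hab, a, b, hb, rfl⟩
end

section
/- Let p be a prime and let F ∈ ℤ[x_0,…,x_r] be an integral form. Assume that F has a simple linear factor over ℚ_p, i.e., F = L·G in ℚ_p[x_0,…,x_r] where L is a nonzero homogeneous polynomial of degree 1 that does not divide G. Then R(F) is dense in ℚ_p. -/
open MvPolynomial

open Filter Topology

namespace MvPolynomial

variable {σ : Type*}

theorem IsHomogeneous.eval_smul_point {R : Type*} [CommSemiring R] {P : MvPolynomial σ R} {d : ℕ}
    (hP : P.IsHomogeneous d) (c : R) (x : σ → R) :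
    eval (c • x) P = c ^ d * eval x P := by
  rw [eval_eq, eval_eq, Finset.mul_sum]
  refine Finset.sum_congr rfl fun m hm ↦ ?_
  have hdeg : ∑ i ∈ m.support, m i = d := by
    rw [← hP (mem_support_iff.mp hm), Finsupp.weight_apply]
    simp [Finsupp.sum]
  simp only [Pi.smul_apply, smul_eq_mul, mul_pow, Finset.prod_mul_distrib, Finset.prod_pow_eq_pow_sum,
    hdeg]
  ring

theorem IsHomogeneous.eval_add_of_one {R : Type*} [CommSemiring R] {L : MvPolynomial σ R}
    (hL : L.IsHomogeneous 1) (x y : σ → R) :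
    eval (x + y) L = eval x L + eval y L := by
  have hmem : L ∈ Submodule.span R (Set.range (X : σ → MvPolynomial σ R)) := by
    rw [← homogeneousSubmodule_one_eq_span_X]
    exact hL
  clear hL
  induction hmem using Submodule.span_induction with
  | mem _ h =>
    obtain ⟨i, rfl⟩ := h
    simp
  | zero => simp
  | add _ _ _ _ h₁ h₂ =>
    rw [map_add, map_add, map_add, h₁, h₂]
    ring
  | smul a _ _ h => simp [smul_eval, h, mul_add]

/-- The Nullstellensatz for a linear form over an infinite field. -/
theorem IsHomogeneous.dvd_of_forall_eval_eq_zero {K : Type*} [Field K] [Infinite K]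
    {L G : MvPolynomial σ K} (hL : L.IsHomogeneous 1) {v : σ → K} (hv : eval v L ≠ 0)
    (h : ∀ a, eval a L = 0 → eval a G = 0) : L ∣ G := by
  let φ : MvPolynomial σ K →ₐ[K] MvPolynomial σ K :=
    MvPolynomial.aeval fun j ↦ X j - C (v j / eval v L) * L
  have hφ_eval (a : σ → K) : eval a (φ G) = eval (a + (-(eval a L / eval v L)) • v) G := by
    have : (eval a).comp φ.toRingHom = eval (a + (-(eval a L / eval v L)) • v) := by
      ext j
      · simp [φ]
      · simp [φ]
        ring
    exact congrArg (fun f : MvPolynomial σ K →+* K ↦ f G) this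
  have hφ_zero : φ G = 0 := by
    refine MvPolynomial.funext fun a ↦ ?_
    rw [hφ_eval, map_zero]
    apply h
    rw [hL.eval_add_of_one, hL.eval_smul_point]
    field_simp
    ring
  have hφ_mk : (Ideal.Quotient.mkₐ K (Ideal.span {L})).comp φ =
      Ideal.Quotient.mkₐ K (Ideal.span {L}) := by
    ext j
    simp only [φ, AlgHom.comp_apply, aeval_X, Ideal.Quotient.mkₐ_eq_mk]
    rw [Ideal.Quotient.eq, Ideal.mem_span_singleton]
    exact ⟨-C (v j / eval v L), by ring⟩
  have hG := congrArg (fun f ↦ f G) hφ_mk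
  simp only [AlgHom.comp_apply, hφ_zero, map_zero, Ideal.Quotient.mkₐ_eq_mk] at hG
  rw [← Ideal.mem_span_singleton, ← Ideal.Quotient.eq_zero_iff_mem]
  exact hG.symm

end MvPolynomial

section ratioSet

variable {p : ℕ} [Fact p.Prime] {n d : ℕ} {F : MvPolynomial (Fin n) ℤ}

theorem eval_div_eval_mem_ratioSet_of_rat (hF : F.IsHomogeneous d) (x y : Fin n → ℚ)
    (hy : eval (fun i ↦ (y i : ℚ_[p])) (F.map (Int.castRingHom ℚ_[p])) ≠ 0) :
    eval (fun i ↦ (x i : ℚ_[p])) (F.map (Int.castRingHom ℚ_[p])) /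
      eval (fun i ↦ (y i : ℚ_[p])) (F.map (Int.castRingHom ℚ_[p])) ∈ ratioSet p F := by
  obtain ⟨b, hb⟩ := IsLocalization.exist_integer_multiples_of_finite
    (nonZeroDivisors ℤ) (Sum.elim x y)
  choose z hz using hb
  have hb0 : ((b : ℤ) : ℚ_[p]) ≠ 0 := Int.cast_ne_zero.mpr (nonZeroDivisors.coe_ne_zero b)
  have key (w : Fin n → ℤ) (q : Fin n → ℚ) (hwq : ∀ i, (w i : ℚ) = (b : ℤ) * q i) :
      ((eval w F : ℤ) : ℚ_[p]) = ((b : ℤ) : ℚ_[p]) ^ d *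
        eval (fun i ↦ (q i : ℚ_[p])) (F.map (Int.castRingHom ℚ_[p])) := by
    rw [← (hF.map (Int.castRingHom ℚ_[p])).eval_smul_point, eval_map,
      ← eq_intCast (Int.castRingHom ℚ_[p]), ← eval₂_id, hom_eval₂, RingHom.comp_id]
    congr 1
    funext i
    have := congrArg (Rat.cast : ℚ → ℚ_[p]) (hwq i)
    simpa using this
  have hx' := key (fun i ↦ z (.inl i)) x fun i ↦ by simpa using hz (.inl i)
  have hy' := key (fun i ↦ z (.inr i)) y fun i ↦ by simpa using hz (.inr i)
  refine ⟨fun i ↦ z (.inl i), fun i ↦ z (.inr i), ?_, ?_⟩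
  · have := mul_ne_zero (pow_ne_zero d hb0) hy
    rw [← hy'] at this
    exact Int.cast_ne_zero.mp this
  · rw [hx', hy', mul_div_mul_left _ _ (pow_ne_zero d hb0)]

theorem eval_div_eval_mem_closure_ratioSet (hF : F.IsHomogeneous d) (x y : Fin n → ℚ_[p])
    (hy : eval y (F.map (Int.castRingHom ℚ_[p])) ≠ 0) :
    eval x (F.map (Int.castRingHom ℚ_[p])) / eval y (F.map (Int.castRingHom ℚ_[p])) ∈
      closure (ratioSet p F) := by
  set P := F.map (Int.castRingHom ℚ_[p])
  have hcont : Continuous fun x ↦ eval x P := MvPolynomial.continuous_eval P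
  have hratio : ContinuousAt (fun z : (Fin n → ℚ_[p]) × (Fin n → ℚ_[p]) ↦
      eval z.1 P / eval z.2 P) (x, y) :=
    (hcont.comp continuous_fst).continuousAt.div (hcont.comp continuous_snd).continuousAt hy
  have hne : ∀ᶠ z : (Fin n → ℚ_[p]) × (Fin n → ℚ_[p]) in 𝓝 (x, y), eval z.2 P ≠ 0 :=
    (hcont.comp continuous_snd).continuousAt.eventually_ne hy
  have hdense : DenseRange (Prod.map (Pi.map fun _ : Fin n ↦ (Rat.cast : ℚ → ℚ_[p]))
      (Pi.map fun _ : Fin n ↦ (Rat.cast : ℚ → ℚ_[p]))) :=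
    (DenseRange.piMap fun _ ↦ Padic.denseRange_ratCast p).prodMap
      (DenseRange.piMap fun _ ↦ Padic.denseRange_ratCast p)
  rw [mem_closure_iff_nhds]
  intro U hU
  obtain ⟨_, ⟨hzU, hz⟩, ⟨q, rfl⟩⟩ :=
    mem_closure_iff_nhds.mp (hdense (x, y)) _ (inter_mem (hratio hU) hne)
  exact ⟨_, hzU, eval_div_eval_mem_ratioSet_of_rat hF q.1 q.2 hz⟩

end ratioSet

/-- If an integral form `F` has a simple linear factor over `ℚ_p`, i.e. `F = L·G` over
`ℚ_p` with `L` a nonzero linear form not dividing `G`, then `R(F)` is dense in `ℚ_p`. -/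
theorem stmt16 (p : ℕ) [Fact p.Prime] (r : ℕ)
    (F : MvPolynomial (Fin (r + 1)) ℤ) (d : ℕ) (hF : F.IsHomogeneous d)
    (L G : MvPolynomial (Fin (r + 1)) ℚ_[p])
    (hL1 : L.IsHomogeneous 1) (hLne : L ≠ 0)
    (hfac : F.map (Int.castRingHom ℚ_[p]) = L * G)
    (hnd : ¬ L ∣ G) :
    Dense (ratioSet p F) := by
  have hFL (x : Fin (r + 1) → ℚ_[p]) :
      eval x (F.map (Int.castRingHom ℚ_[p])) = eval x L * eval x G := by
    rw [hfac, map_mul]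
  obtain ⟨v, hv⟩ : ∃ v, eval v L ≠ 0 := by
    by_contra! h
    exact hLne (MvPolynomial.funext fun x ↦ by rw [h, map_zero])
  obtain ⟨a, haL, haG⟩ : ∃ a, eval a L = 0 ∧ eval a G ≠ 0 := by
    by_contra! h
    exact hnd (hL1.dvd_of_forall_eval_eq_zero hv h)
  have hline (s : ℚ_[p]) : eval (a + s • v) L = s * eval v L := by
    rw [hL1.eval_add_of_one, hL1.eval_smul_point, haL, zero_add, pow_one]
  intro t
  have hcont (c : ℚ_[p]) : Tendsto (fun s : ℚ_[p] ↦ eval (a + (c * s) • v) G) (𝓝[≠] 0)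
      (𝓝 (eval a G)) := by
    have h : Continuous fun s : ℚ_[p] ↦ eval (a + (c * s) • v) G :=
      (MvPolynomial.continuous_eval G).comp (by fun_prop)
    simpa using (h.tendsto 0).mono_left nhdsWithin_le_nhds
  have hcont_one : Tendsto (fun s : ℚ_[p] ↦ eval (a + s • v) G) (𝓝[≠] 0) (𝓝 (eval a G)) := by
    simpa using hcont 1
  have hlim : Tendsto (fun s : ℚ_[p] ↦ t * (eval (a + (t * s) • v) G / eval (a + s • v) G))
      (𝓝[≠] 0) (𝓝 t) := by
    simpa [div_self haG] using ((hcont t).div hcont_one haG).const_mul t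
  rw [← closure_closure]
  refine mem_closure_of_tendsto hlim ?_
  filter_upwards [hcont_one.eventually_ne haG, self_mem_nhdsWithin] with s hsG (hs : s ≠ 0)
  have hy : eval (a + s • v) (F.map (Int.castRingHom ℚ_[p])) ≠ 0 := by
    rw [hFL, hline]
    exact mul_ne_zero (mul_ne_zero hs hv) hsG
  convert eval_div_eval_mem_closure_ratioSet hF (a + (t * s) • v) (a + s • v) hy using 1
  rw [hFL, hFL, hline, hline]
  field_simp
end

section
/- Let F ∈ ℤ[x_0,…,x_n] be a form (homogeneous polynomial with integer coefficients), and for a prime p let F_p denote its reduction modulo p. Then o(F) = n + 1 (order over ℚ) if and only if o(F_p) = n + 1 (order over 𝔽_p) for all but finitely many primes p. -/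
open MvPolynomial

/-- The order of a form over a commutative ring: the smallest `m` such that after an
invertible linear change of variables the polynomial involves at most `m` variables. -/
noncomputable def formOrder {n : ℕ} {R : Type*} [CommRing R] (F : MvPolynomial (Fin n) R) : ℕ :=
  sInf { m | ∃ A : Matrix (Fin n) (Fin n) R, IsUnit A.det ∧
    ((MvPolynomial.aeval (fun i => ∑ j, MvPolynomial.C (A i j) * MvPolynomial.X j) F).vars).card ≤ m }

/-- The algebra endomorphism sending `X i` to the linear form given by the `i`-th row of `A`. -/
noncomputable def linearSubst {n : ℕ} {R : Type*} [CommRing R] (A : Matrix (Fin n) (Fin n) R) :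
    MvPolynomial (Fin n) R →ₐ[R] MvPolynomial (Fin n) R :=
  aeval (fun i => ∑ j, C (A i j) * X j)

/-- The derivative of `F` in the direction `v`. -/
noncomputable def directionalDeriv {n : ℕ} {R : Type*} [CommRing R] (v : Fin n → R)
    (F : MvPolynomial (Fin n) R) : MvPolynomial (Fin n) R :=
  ∑ i, C (v i) * pderiv i F

/-- The coefficients of the partial derivatives of `F`, one column for each variable. -/
noncomputable def gradientMatrix {n : ℕ} {R : Type*} [CommRing R] (F : MvPolynomial (Fin n) R) :
    Matrix (Finset.univ.biUnion fun i => (pderiv i F).support) (Fin n) R :=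
  fun m i => coeff m (pderiv i F)

section

variable {n : ℕ} {R : Type*} [CommRing R]

lemma pderiv_linearSubst (A : Matrix (Fin n) (Fin n) R) (F : MvPolynomial (Fin n) R)
    (j : Fin n) :
    pderiv j (linearSubst A F) = linearSubst A (directionalDeriv (fun i => A i j) F) := by
  classical
  induction F using MvPolynomial.induction_on with
  | C a => simp [linearSubst, directionalDeriv, algebraMap_eq]
  | add p q hp hq =>
    simp only [directionalDeriv, map_add, mul_add, Finset.sum_add_distrib] at hp hq ⊢
    rw [hp, hq]
  | mul_X p k hp =>
    have hX : pderiv j (linearSubst A (X k)) = C (A k j) := by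
      simp [linearSubst, Pi.single_apply]
    have hD : directionalDeriv (fun i => A i j) (p * X k)
        = directionalDeriv (fun i => A i j) p * X k + p * C (A k j) := by
      simp only [directionalDeriv, pderiv_mul, mul_add, Finset.sum_add_distrib, Finset.sum_mul]
      simp [Pi.single_apply, mul_comm, mul_left_comm]
    have hC : linearSubst A (C (A k j)) = C (A k j) := by
      simp [linearSubst, algebraMap_eq]
    rw [hD, map_mul, pderiv_mul, hp, hX, map_add, map_mul, map_mul, hC]

lemma linearSubst_injective {A : Matrix (Fin n) (Fin n) R} (hA : IsUnit A.det) :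
    Function.Injective (linearSubst A) := by
  have h : (linearSubst A⁻¹).comp (linearSubst A) = AlgHom.id R _ := by
    apply algHom_ext
    intro i
    have hmul (k : Fin n) : ∑ j, A i j * A⁻¹ j k = (1 : Matrix (Fin n) (Fin n) R) i k := by
      rw [← Matrix.mul_nonsing_inv A hA, Matrix.mul_apply]
    calc (linearSubst A⁻¹) (linearSubst A (X i))
        = ∑ j, ∑ k, C (A i j * A⁻¹ j k) * X k := by
          simp [linearSubst, algebraMap_eq, Finset.mul_sum, mul_assoc]
      _ = X i := by
          rw [Finset.sum_comm]
          simp_rw [← Finset.sum_mul, ← map_sum, hmul]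
          simp [Matrix.one_apply]
  exact Function.LeftInverse.injective (g := linearSubst A⁻¹) fun p => DFunLike.congr_fun h p

lemma linearSubst_one : linearSubst (1 : Matrix (Fin n) (Fin n) R) = AlgHom.id R _ := by
  apply algHom_ext
  intro i
  simp [linearSubst, Matrix.one_apply]

/-- If the nonzero natural numbers up to the degree are nonzero in the ring, a polynomial with
vanishing partial derivative does not involve the corresponding variable. -/
lemma notMem_vars_of_pderiv_eq_zero [NoZeroDivisors R] {d : ℕ} {G : MvPolynomial (Fin n) R}
    (hG : G.IsHomogeneous d) (hd : ∀ k : ℕ, 0 < k → k ≤ d → (k : R) ≠ 0) {j : Fin n}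
    (h : pderiv j G = 0) : j ∉ G.vars := by
  rw [mem_vars_iff_mem_support]
  rintro ⟨m, hm, hj⟩
  rw [Finsupp.mem_support_iff] at hj
  rw [mem_support_iff] at hm
  have hdeg : m.degree = d := by
    rw [← hG hm, Finsupp.degree_eq_weight_one]
    rfl
  have hle : m j ≤ d := hdeg ▸ Finsupp.le_degree j m
  have hc := coeff_pderiv (i := j) G (m - Finsupp.single j 1)
  have hs : m - Finsupp.single j 1 + Finsupp.single j 1 = m :=
    Finsupp.sub_add_single_one_cancel hj
  have hmj : (m - Finsupp.single j 1 : Fin n →₀ ℕ) j + 1 = m j := by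
    rw [Finsupp.tsub_apply, Finsupp.single_eq_same]
    omega
  rw [h, coeff_zero, hs, ← Nat.cast_add_one, hmj] at hc
  exact mul_ne_zero hm (hd _ (Nat.pos_of_ne_zero hj) hle) hc.symm

lemma exists_directionalDeriv_eq_zero_of_formOrder_ne [Nontrivial R]
    {G : MvPolynomial (Fin n) R} (h : formOrder G ≠ n) :
    ∃ v : Fin n → R, v ≠ 0 ∧ directionalDeriv v G = 0 := by
  set S := { m | ∃ A : Matrix (Fin n) (Fin n) R, IsUnit A.det ∧
    (linearSubst A G).vars.card ≤ m }
  have hS : formOrder G = sInf S := rfl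
  have hn : n ∈ S := ⟨1, by simp, by simpa using Finset.card_le_univ (linearSubst 1 G).vars⟩
  have hlt : formOrder G < n := lt_of_le_of_ne (hS ▸ Nat.sInf_le hn) h
  obtain ⟨A, hA, hcard⟩ : formOrder G ∈ S := hS ▸ Nat.sInf_mem ⟨n, hn⟩
  obtain ⟨j, hj⟩ : ∃ j, j ∉ (linearSubst A G).vars := by
    by_contra! hall
    rw [Finset.eq_univ_of_forall hall, Finset.card_univ, Fintype.card_fin] at hcard
    omega
  refine ⟨fun i => A i j, fun h0 => ?_, ?_⟩
  · exact hA.ne_zero (Matrix.det_eq_zero_of_column_eq_zero j (congrFun h0))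
  · apply linearSubst_injective hA
    rw [map_zero, ← pderiv_linearSubst, pderiv_eq_zero_of_notMem_vars hj]

lemma formOrder_ne_of_directionalDeriv_eq_zero {K : Type*} [Field K] {d : ℕ}
    {G : MvPolynomial (Fin n) K} (hG : G.IsHomogeneous d)
    (hd : ∀ k : ℕ, 0 < k → k ≤ d → (k : K) ≠ 0) {v : Fin n → K} (hv : v ≠ 0)
    (h : directionalDeriv v G = 0) : formOrder G ≠ n := by
  obtain ⟨j, hj⟩ := Function.ne_iff.mp hv
  set A := (1 : Matrix (Fin n) (Fin n) K).updateCol j v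
  have hdet : A.det = v j := by
    rw [← Matrix.cramer_apply, Matrix.cramer_one]
    rfl
  have hcol : (fun i => A i j) = v := by
    ext i
    simp [A]
  have hhom : (linearSubst A G).IsHomogeneous d := by
    have := hG.aeval (n := 1) (fun i => ∑ j, C (A i j) * X j)
      fun i => IsHomogeneous.sum _ _ _ fun k _ => isHomogeneous_C_mul_X _ _
    rwa [one_mul] at this
  have hnot : j ∉ (linearSubst A G).vars :=
    notMem_vars_of_pderiv_eq_zero hhom hd (by rw [pderiv_linearSubst, hcol, h, map_zero])
  have hlt : (linearSubst A G).vars.card < n := by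
    simpa using Finset.card_lt_univ_of_notMem hnot
  refine ne_of_lt (lt_of_le_of_lt (Nat.sInf_le ⟨A, ?_, le_rfl⟩) hlt)
  rw [hdet]
  exact isUnit_iff_ne_zero.mpr hj

lemma coeff_directionalDeriv_map {S : Type*} [CommRing S] (φ : R →+* S) (v : Fin n → S)
    (F : MvPolynomial (Fin n) R) (m : Fin n →₀ ℕ) :
    coeff m (directionalDeriv v (map φ F)) = ∑ i, φ (coeff m (pderiv i F)) * v i := by
  simp [directionalDeriv, coeff_sum, pderiv_map, coeff_map, mul_comm]

lemma directionalDeriv_map {S : Type*} [CommRing S] (φ : R →+* S) (v : Fin n → R)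
    (F : MvPolynomial (Fin n) R) :
    directionalDeriv (φ ∘ v) (map φ F) = map φ (directionalDeriv v F) := by
  simp [directionalDeriv, pderiv_map]

lemma directionalDeriv_eq_zero_of_mulVec_eq_zero {v : Fin n → R} {F : MvPolynomial (Fin n) R}
    (h : (gradientMatrix F).mulVec v = 0) : directionalDeriv v F = 0 := by
  ext m
  have hm := coeff_directionalDeriv_map (RingHom.id R) v F m
  rw [map_id] at hm
  rw [hm, coeff_zero]
  by_cases hmem : m ∈ Finset.univ.biUnion fun i => (pderiv i F).support
  · exact congrFun h ⟨m, hmem⟩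
  · refine Finset.sum_eq_zero fun i _ => ?_
    have : coeff m (pderiv i F) = 0 := by
      by_contra hne
      exact hmem (Finset.mem_biUnion.mpr ⟨i, Finset.mem_univ i, mem_support_iff.mpr hne⟩)
    simp [this]

/-- The determinant of the Gram matrix of the partial derivatives of `F`. -/
noncomputable def gradientGramDet (F : MvPolynomial (Fin n) R) : R :=
  ((gradientMatrix F).transpose * gradientMatrix F).det

lemma map_gradientGramDet_eq_zero {K : Type*} [CommRing K] [IsDomain K] (φ : R →+* K)
    {F : MvPolynomial (Fin n) R} (h : formOrder (map φ F) ≠ n) :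
    φ (gradientGramDet F) = 0 := by
  obtain ⟨v, hv, hv0⟩ := exists_directionalDeriv_eq_zero_of_formOrder_ne h
  have hM : ((gradientMatrix F).map φ).mulVec v = 0 := by
    ext m
    exact (coeff_directionalDeriv_map φ v F m).symm.trans (by rw [hv0, coeff_zero]; rfl)
  rw [gradientGramDet, RingHom.map_det, RingHom.mapMatrix_apply, Matrix.map_mul]
  refine Matrix.exists_mulVec_eq_zero_iff.mp ⟨v, hv, ?_⟩
  rw [← Matrix.mulVec_mulVec, hM, Matrix.mulVec_zero]

lemma exists_directionalDeriv_eq_zero_of_gradientGramDet {F : MvPolynomial (Fin n) ℤ}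
    (h : gradientGramDet F = 0) : ∃ v : Fin n → ℤ, v ≠ 0 ∧ directionalDeriv v F = 0 := by
  obtain ⟨v, hv, hv0⟩ := Matrix.exists_mulVec_eq_zero_iff.mpr h
  refine ⟨v, hv, directionalDeriv_eq_zero_of_mulVec_eq_zero ?_⟩
  rw [← dotProduct_self_eq_zero, Matrix.dotProduct_mulVec, ← Matrix.mulVec_transpose,
    Matrix.mulVec_mulVec, hv0, zero_dotProduct]

end

/-- For a form `F ∈ ℤ[x_0,…,x_n]`, the order of `F` over `ℚ` is `n + 1` if and only if for
all but finitely many primes `p` the order of the reduction `F_p` over `𝔽_p` is `n + 1`. -/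
theorem stmt19 (n : ℕ) (F : MvPolynomial (Fin (n + 1)) ℤ)
    (d : ℕ) (hF : F.IsHomogeneous d) :
    formOrder (F.map (Int.castRingHom ℚ)) = n + 1 ↔
    {p : ℕ | p.Prime ∧ formOrder (F.map (Int.castRingHom (ZMod p))) ≠ n + 1}.Finite := by
  by_cases hD : gradientGramDet F = 0
  · obtain ⟨v, hv, hv0⟩ := exists_directionalDeriv_eq_zero_of_gradientGramDet hD
    have key {K : Type} [Field K] (hd : ∀ k : ℕ, 0 < k → k ≤ d → (k : K) ≠ 0)
        {j : Fin (n + 1)} (hj : ((v j : ℤ) : K) ≠ 0) :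
        formOrder (F.map (Int.castRingHom K)) ≠ n + 1 := by
      refine formOrder_ne_of_directionalDeriv_eq_zero (hF.map _) hd
        (v := Int.castRingHom K ∘ v) (fun h0 => hj (congrFun h0 j)) ?_
      rw [directionalDeriv_map, hv0, map_zero]
    obtain ⟨j, hj⟩ := Function.ne_iff.mp hv
    refine iff_of_false (key (fun k hk _ => by exact_mod_cast hk.ne') (j := j)
      (by exact_mod_cast hj)) fun hfin => ?_
    refine Nat.infinite_setOfPred_prime ((hfin.union (Set.finite_Iic (max d (v j).natAbs))).subset ?_)
    intro p hp
    rw [Set.mem_union, Set.mem_Iic, or_iff_not_imp_right, not_le, max_lt_iff]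
    rintro ⟨hdp, hvp⟩
    have : Fact p.Prime := ⟨hp⟩
    refine ⟨hp, key (fun k hk hkd h0 => ?_) (j := j) fun h0 => ?_⟩
    · rw [ZMod.natCast_eq_zero_iff] at h0
      exact absurd (Nat.le_of_dvd hk h0) (by omega)
    · rw [ZMod.intCast_zmod_eq_zero_iff_dvd, Int.natCast_dvd] at h0
      exact absurd (Nat.le_of_dvd (Int.natAbs_pos.mpr hj) h0) (by omega)
  · refine iff_of_true ?_ ?_
    · by_contra h
      exact hD (by simpa using map_gradientGramDet_eq_zero (Int.castRingHom ℚ) h)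
    · refine (Set.finite_Iic (gradientGramDet F).natAbs).subset ?_
      rintro p ⟨hp, hne⟩
      have : Fact p.Prime := ⟨hp⟩
      have h0 := map_gradientGramDet_eq_zero (Int.castRingHom (ZMod p)) hne
      rw [eq_intCast, ZMod.intCast_zmod_eq_zero_iff_dvd, Int.natCast_dvd] at h0
      exact Nat.le_of_dvd (Int.natAbs_pos.mpr hD) h0
end
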